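/- Let G = (L, E) be a countable graph with no loops, isolated vertices, or multiple edges, with graph distance ρ and vertex degrees m_ℓ, and suppose there is a nondecreasing function φ : ℕ → [1, ∞) with ∑_{n=1}^∞ n/φ(n) < ∞ such that ρ(ℓ, ℓ') ≥ φ(min{m_ℓ, m_{ℓ'}}) for all vertices ℓ, ℓ'. Then there exists δ ∈ (0,1), depending only on φ, such that for every family of interaction potentials v = (v_{ℓℓ'})_{⟨ℓ,ℓ'⟩∈E} with κ(v) := sup_{⟨ℓ,ℓ'⟩∈E} 16[exp(4‖v_{ℓℓ'}‖) − 1] ≤ δ, the set 𝒢(v) of Euclidean Gibbs measures is a singleton. -/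

import Mathlib

open MeasureTheory

noncomputable section

/-- The loop space over `M`: continuous paths on `[0,1]` with equal endpoints,
with the supremum metric. -/
def Loop (M : Type*) [TopologicalSpace M] : Type _ :=
  {x : C(unitInterval, M) // x 0 = x 1}

variable {M : Type*} [MetricSpace M]

instance : MetricSpace (Loop M) :=
  inferInstanceAs (MetricSpace {x : C(unitInterval, M) // x 0 = x 1})

instance : MeasurableSpace (Loop M) := borel _

instance : BorelSpace (Loop M) := ⟨rfl⟩

/-- The underlying continuous path of a loop. -/
def Loop.path : Loop M → C(unitInterval, M) := Subtype.val

/-- `V(x,y) = ∫₀¹ v(x(τ), y(τ)) dτ`, the time-averaged pair interaction. -/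
def pathV (v : C(M × M, ℝ)) (x y : Loop M) : ℝ :=
  ∫ τ : unitInterval, v (x.path τ, y.path τ)

variable {L : Type*} [DecidableEq L] (G : SimpleGraph L) [DecidableRel G.Adj]
  [G.LocallyFinite] (χ : L → Measure (Loop M)) (v : L → L → C(M × M, ℝ))

/-- The configuration `x_Λ × y_{Λᶜ}`. -/
def Finset.glue (Λ : Finset L) (x : Λ → Loop M) (y : (ℓ : L) → Loop M) (ℓ : L) : Loop M :=
  if h : ℓ ∈ Λ then x ⟨ℓ, h⟩ else y ℓ

/-- The product measure `χ_Λ = ⊗_{ℓ ∈ Λ} χ_ℓ`. -/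
def chiProd (Λ : Finset L) : Measure (Λ → Loop M) :=
  Measure.pi fun ℓ : Λ => χ ℓ

/-- `V_Λ(x_Λ | y)`: interaction energy of `x_Λ` inside `Λ` plus its interaction with
the boundary condition `y` outside `Λ`.  (Each unordered interior edge is counted twice in
the double sum, whence the factor 1/2.) -/
def condV (Λ : Finset L) (x : Λ → Loop M) (y : (ℓ : L) → Loop M) : ℝ :=
  (1 / 2) * ∑ ℓ : Λ, ∑ ℓ' : Λ,
      (if G.Adj ℓ ℓ' then pathV (v ℓ ℓ') (x ℓ) (x ℓ') else 0)
    + ∑ ℓ : Λ, ∑ ℓ' ∈ G.neighborFinset (ℓ : L) \ Λ, pathV (v ℓ ℓ') (x ℓ) (y ℓ')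

/-- The local Gibbs kernel `π_Λ(dx | y)` as a measure on configuration space. -/
def gibbsKernel (Λ : Finset L) (y : (ℓ : L) → Loop M) : Measure ((ℓ : L) → Loop M) :=
  (∫⁻ x, ENNReal.ofReal (Real.exp (condV G v Λ x y)) ∂chiProd χ Λ)⁻¹ •
    Measure.map (fun x => Finset.glue Λ x y)
      ((chiProd χ Λ).withDensity fun x => ENNReal.ofReal (Real.exp (condV G v Λ x y)))

/-- `μ` is a Euclidean Gibbs measure: a probability measure satisfying the DLR equation
`μ(B) = ∫ π_Λ(B|x) μ(dx)` for every finite non-void `Λ`. -/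
def IsGibbs (μ : Measure ((ℓ : L) → Loop M)) : Prop :=
  IsProbabilityMeasure μ ∧
    ∀ Λ : Finset L, Λ.Nonempty → μ.bind (gibbsKernel G χ v Λ) = μ

end

set_option linter.unusedSectionVars false

namespace SimpleGraph

variable {V : Type*} (G : SimpleGraph V) [G.LocallyFinite]

/-- The total degree of the vertices visited by a walk. -/
noncomputable def Walk.degreeSum {G : SimpleGraph V} [G.LocallyFinite] {u w : V}
    (p : G.Walk u w) : ℝ :=
  (p.support.map fun x => (G.degree x : ℝ)).sum

/-- There are finitely many walks of length `n` from `u`, and their weights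
`exp (-∑ degrees)` add up to at most one. -/
lemma exists_finset_walks_sum_exp_le (n : ℕ) (u : V) :
    ∃ T : Finset (Σ w, G.Walk u w), (∀ p, p ∈ T ↔ p.2.length = n) ∧
      ∑ p ∈ T, Real.exp (-p.2.degreeSum) ≤ 1 := by
  classical
  induction n generalizing u with
  | zero =>
    refine ⟨{⟨u, Walk.nil⟩}, ?_, ?_⟩
    · rintro ⟨w, p⟩
      cases p with
      | nil => simp
      | cons h p =>
        simp only [Finset.mem_singleton, Walk.length_cons, Nat.add_eq_zero_iff, one_ne_zero,
          and_false, iff_false]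
        intro hp
        have := congrArg (fun p : Σ w, G.Walk u w => p.2.length) hp
        simp at this
    · simp [Walk.degreeSum]
  | succ n ih =>
    choose T hT hsum using ih
    let ι : (Σ w : G.neighborSet u, Σ x, G.Walk w.1 x) → Σ x, G.Walk u x :=
      fun q => ⟨q.2.1, Walk.cons (show G.Adj u q.1.1 from q.1.2) q.2.2⟩
    have hι : Function.Injective ι := by
      rintro ⟨⟨w, hw⟩, x, p⟩ ⟨⟨w', hw'⟩, x', p'⟩ h
      simp only [ι, Sigma.mk.injEq] at h
      obtain ⟨rfl, h⟩ := h
      have h := eq_of_heq h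
      rw [Walk.cons.injEq] at h
      obtain ⟨rfl, h⟩ := h
      rw [eq_of_heq h]
    refine ⟨((Finset.univ : Finset (G.neighborSet u)).sigma fun w => T w.1).map ⟨ι, hι⟩, ?_, ?_⟩
    · rintro ⟨x, p⟩
      simp only [Finset.mem_map, Finset.mem_sigma, Finset.mem_univ, true_and, hT,
        Function.Embedding.coeFn_mk, ι]
      constructor
      · rintro ⟨⟨⟨w, hw⟩, y, q⟩, hq, h⟩
        cases h
        rw [Walk.length_cons, hq]
      · intro hp
        cases p with
        | nil => simp at hp
        | cons h q => exact ⟨⟨⟨_, h⟩, _, q⟩, by simpa using hp, rfl⟩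
    · rw [Finset.sum_map, Finset.sum_sigma]
      have key : ∀ w : G.neighborSet u, ∑ q ∈ T w.1,
          Real.exp (-(ι ⟨w, q⟩).2.degreeSum) ≤ Real.exp (-(G.degree u : ℝ)) := by
        intro w
        have : ∀ q ∈ T w.1, Real.exp (-(ι ⟨w, q⟩).2.degreeSum) =
            Real.exp (-(G.degree u : ℝ)) * Real.exp (-q.2.degreeSum) := by
          intro q _
          rw [← Real.exp_add]
          simp only [ι, Walk.degreeSum, Walk.support_cons, List.map_cons, List.sum_cons]
          rw [neg_add]
        rw [Finset.sum_congr rfl this, ← Finset.mul_sum]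
        exact mul_le_of_le_one_right (Real.exp_pos _).le (hsum _)
      refine (Finset.sum_le_sum fun w _ => key w).trans ?_
      rw [Finset.sum_const, nsmul_eq_mul, Finset.card_univ, G.card_neighborSet_eq_degree,
        Real.exp_neg, ← div_eq_mul_inv, div_le_one (Real.exp_pos _)]
      linarith [Real.add_one_le_exp (G.degree u : ℝ)]

/-- A set of integers in `[0, N]` with gaps at least `d` has at most `1 + N / d` elements. -/
lemma card_le_of_gaps {N : ℕ} {d : ℝ} (hd : 1 ≤ d) (s : Finset ℕ) (hs : ∀ i ∈ s, i ≤ N)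
    (hgap : ∀ i ∈ s, ∀ j ∈ s, i < j → d ≤ (j : ℝ) - i) : (s.card : ℝ) ≤ 1 + N / d := by
  have hd0 : 0 < d := by linarith
  have h1 : s.card ≤ (Finset.range (⌊(N : ℝ) / d⌋₊ + 1)).card := by
    refine Finset.card_le_card_of_injOn (fun i => ⌊(i : ℝ) / d⌋₊) ?_ ?_
    · intro i hi
      have : (i : ℝ) ≤ N := by exact_mod_cast hs i hi
      simp only [Finset.coe_range, Set.mem_Iio, Nat.lt_succ_iff]
      exact Nat.floor_le_floor (by gcongr)
    · have aux : ∀ i ∈ s, ∀ j ∈ s, i < j → ⌊(i : ℝ) / d⌋₊ ≠ ⌊(j : ℝ) / d⌋₊ := by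
        intro i hi j hj hij he
        have h2 : (j : ℝ) / d < ⌊(j : ℝ) / d⌋₊ + 1 := Nat.lt_floor_add_one _
        have h3 : (⌊(i : ℝ) / d⌋₊ : ℝ) ≤ (i : ℝ) / d := Nat.floor_le (by positivity)
        have h4 : (i : ℝ) / d + 1 ≤ (j : ℝ) / d := by
          rw [← sub_nonneg]
          have := hgap i hi j hj hij
          have : 0 ≤ ((j : ℝ) - i - d) / d := div_nonneg (by linarith) hd0.le
          field_simp at this ⊢
          linarith
        rw [he] at h3
        linarith
      intro i hi j hj he
      by_contra hne
      rcases lt_or_gt_of_ne hne with h | h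
      · exact aux i hi j hj h he
      · exact aux j hj i hi h he.symm
  rw [Finset.card_range] at h1
  have h2 : (⌊(N : ℝ) / d⌋₊ : ℝ) ≤ N / d := Nat.floor_le (by positivity)
  have h3 : (s.card : ℝ) ≤ (⌊(N : ℝ) / d⌋₊ : ℝ) + 1 := by exact_mod_cast h1
  linarith

/-- Vertices of large degree are far apart. -/
def DegreeSeparated (φ : ℕ → ℝ) : Prop :=
  ∀ x y : V, x ≠ y → G.Reachable x y → φ (min (G.degree x) (G.degree y)) ≤ (G.dist x y : ℝ)

variable {G} {φ : ℕ → ℝ}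

lemma Walk.IsPath.degreeSum_le (hφ1 : ∀ n, 1 ≤ φ n) (hφmono : Monotone φ)
    (hφsum : Summable fun n : ℕ => (n : ℝ) / φ n) (hG : G.DegreeSeparated φ) {u w : V}
    {p : G.Walk u w} (hp : p.IsPath)
    (hdeg : ∀ x ∈ p.support, φ (G.degree x) ≤ 2 * p.length + 2) :
    p.degreeSum ≤ (∑' n : ℕ, (n : ℝ) / φ n) * (3 * p.length + 2) := by
  classical
  set S := ∑' n : ℕ, (n : ℝ) / φ n with hS
  set N := p.length with hN
  have hφ0 : ∀ n, 0 < φ n := fun n => one_pos.trans_le (hφ1 n)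
  have hnn : ∀ n : ℕ, 0 ≤ (n : ℝ) / φ n := fun n => div_nonneg n.cast_nonneg (hφ0 n).le
  have hS0 : 0 ≤ S := tsum_nonneg hnn
  have hle : ∀ n : ℕ, (n : ℝ) ≤ S * φ n := fun n => by
    rw [← div_le_iff₀ (hφ0 n)]
    exact hφsum.le_tsum n fun m _ => hnn m
  set K := ⌊S * (2 * N + 2)⌋₊ with hK
  have hKS : (K : ℝ) ≤ S * (2 * N + 2) := Nat.floor_le (by positivity)
  have hdK : ∀ x ∈ p.support, G.degree x ≤ K := fun x hx =>
    Nat.le_floor ((hle _).trans (mul_le_mul_of_nonneg_left (hdeg x hx) hS0))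
  have hsum : p.degreeSum = ∑ i ∈ Finset.range (N + 1), (G.degree (p.getVert i) : ℝ) := by
    have : ∀ {a b : V} (q : G.Walk a b),
        q.degreeSum = ∑ i ∈ Finset.range (q.length + 1), (G.degree (q.getVert i) : ℝ) := by
      intro a b q
      induction q with
      | nil =>
        rw [Walk.length_nil, Finset.sum_range_one]
        exact add_zero _
      | cons h q ih =>
        rw [Walk.length_cons, Finset.sum_range_succ']
        refine (add_comm _ _).trans (congrArg₂ (· + ·) ?_ rfl)
        exact ih
    exact this p
  have hcount : ∀ k ∈ Finset.Icc 1 K,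
      (((Finset.range (N + 1)).filter fun i => k ≤ G.degree (p.getVert i)).card : ℝ) ≤
        1 + N * ((k : ℝ) / φ k) := by
    intro k hk
    have hk1 : (1 : ℝ) ≤ k := by exact_mod_cast (Finset.mem_Icc.1 hk).1
    refine (card_le_of_gaps (N := N) (hφ1 k) _ ?_ ?_).trans ?_
    · intro i hi
      have := (Finset.mem_filter.1 hi).1
      rw [Finset.mem_range] at this
      omega
    · intro i hi j hj hij
      simp only [Finset.mem_filter, Finset.mem_range] at hi hj
      have hne : p.getVert i ≠ p.getVert j := by
        intro h
        exact hij.ne (hp.getVert_injOn (by simp; omega) (by simp; omega) h)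
      let q := (p.drop i).take (j - i)
      have hq : (p.drop i).getVert (j - i) = p.getVert j := by
        rw [Walk.drop_getVert]
        congr 1
        omega
      let q' : G.Walk (p.getVert i) (p.getVert j) := q.copy rfl hq
      have hlen : q'.length ≤ j - i := by
        simp only [q', q, Walk.length_copy, Walk.take_length]
        exact min_le_left _ _
      have hd : (G.dist (p.getVert i) (p.getVert j) : ℝ) ≤ (j : ℝ) - i := by
        rw [← Nat.cast_sub hij.le]
        exact_mod_cast (dist_le q').trans hlen
      exact ((hφmono (le_min hi.2 hj.2)).trans (hG _ _ hne ⟨q'⟩)).trans hd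
    · have : (N : ℝ) / φ k ≤ N * ((k : ℝ) / φ k) := by
        rw [mul_div_assoc']
        gcongr
        · exact (hφ0 k).le
        · nlinarith [(N.cast_nonneg : (0 : ℝ) ≤ N)]
      linarith
  have hlayer : ∀ i ∈ Finset.range (N + 1), (G.degree (p.getVert i) : ℝ) =
      ∑ k ∈ Finset.Icc 1 K, if k ≤ G.degree (p.getVert i) then (1 : ℝ) else 0 := by
    intro i _
    have h := hdK _ (p.getVert_mem_support i)
    rw [Finset.sum_ite, Finset.sum_const_zero, add_zero, Finset.sum_const, nsmul_one]
    congr 1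
    rw [show (Finset.Icc 1 K).filter (fun k => k ≤ G.degree (p.getVert i)) =
      Finset.Icc 1 (G.degree (p.getVert i)) by ext; simp; omega]
    simp
  rw [hsum, Finset.sum_congr rfl hlayer, Finset.sum_comm]
  have h1 : ∀ k ∈ Finset.Icc 1 K, (∑ i ∈ Finset.range (N + 1),
      if k ≤ G.degree (p.getVert i) then (1 : ℝ) else 0) ≤ 1 + N * ((k : ℝ) / φ k) := by
    intro k hk
    rw [Finset.sum_boole]
    exact hcount k hk
  refine (Finset.sum_le_sum h1).trans ?_
  rw [Finset.sum_add_distrib, ← Finset.mul_sum]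
  have h2 : ∑ k ∈ Finset.Icc 1 K, (k : ℝ) / φ k ≤ S := hφsum.sum_le_tsum _ fun m _ => hnn m
  have h3 : (N : ℝ) * ∑ k ∈ Finset.Icc 1 K, (k : ℝ) / φ k ≤ N * S :=
    mul_le_mul_of_nonneg_left h2 N.cast_nonneg
  simp only [Finset.sum_const, Nat.card_Icc, Nat.add_sub_cancel, nsmul_one]
  linarith

/-- Arbitrarily large radii control the degrees in the corresponding balls. -/
lemma DegreeSeparated.exists_radius (hφ1 : ∀ n, 1 ≤ φ n) (hφmono : Monotone φ)
    (hG : G.DegreeSeparated φ) (u : V) (n : ℕ) :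
    ∃ N ≥ n, ∀ z, G.Reachable u z → G.dist u z ≤ N → φ (G.degree z) ≤ 2 * N + 2 := by
  by_cases hn : ∀ z, G.Reachable u z → G.dist u z ≤ n → φ (G.degree z) ≤ 2 * n + 2
  · exact ⟨n, le_rfl, hn⟩
  push Not at hn
  obtain ⟨y, hy, hdy, hφy⟩ := hn
  set r := ⌈φ (G.degree y)⌉₊ with hr
  have h1 : φ (G.degree y) ≤ r := Nat.le_ceil _
  have h2 : (r : ℝ) < φ (G.degree y) + 1 :=
    Nat.ceil_lt_add_one (zero_le_one.trans (hφ1 _))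
  have h3 : 2 * n + 2 < r := by exact_mod_cast hφy.trans_le h1
  refine ⟨r - 1 - n, by omega, fun z hz hdz => ?_⟩
  have h4 : ((r - 1 - n : ℕ) : ℝ) = r - 1 - n := by
    rw [Nat.cast_sub (by omega), Nat.cast_sub (by omega)]
    simp
  have hnr : (2 * n + 2 : ℝ) < r := by exact_mod_cast h3
  have hle : φ (G.degree z) ≤ φ (G.degree y) := by
    by_cases hzy : y = z
    · rw [hzy]
    have hd := hG y z hzy (hy.symm.trans hz)
    have htri : G.dist y z ≤ n + (r - 1 - n) := by
      obtain ⟨p, hp⟩ := hy.exists_walk_length_eq_dist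
      obtain ⟨q, hq⟩ := hz.exists_walk_length_eq_dist
      refine (dist_le (p.reverse.append q)).trans ?_
      rw [Walk.length_append, Walk.length_reverse, hp, hq]
      omega
    have htri' : (G.dist y z : ℝ) ≤ n + (r - 1 - n) := by
      rw [← h4]
      exact_mod_cast htri
    have hlt : φ (min (G.degree y) (G.degree z)) < φ (G.degree y) := by linarith
    refine hφmono ?_
    by_contra hcon
    rw [min_eq_left (not_le.1 hcon).le] at hlt
    exact hlt.false
  rw [h4]
  linarith

/-- For small `q`, the paths of some arbitrarily large length from `u` have small total weight. -/
lemma DegreeSeparated.exists_paths (hφ1 : ∀ n, 1 ≤ φ n) (hφmono : Monotone φ)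
    (hφsum : Summable fun n : ℕ => (n : ℝ) / φ n) (hG : G.DegreeSeparated φ)
    [DecidableEq V] {q : ℝ} (hq0 : 0 ≤ q)
    (hq : q ≤ Real.exp (-(3 * ∑' n : ℕ, (n : ℝ) / φ n)) / 2) {ε : ℝ} (hε : 0 < ε) (u : V) :
    ∃ (N : ℕ) (P : Finset (Finset (Sym2 V))),
      (∀ (w : V) (p : G.Walk u w), p.IsPath → p.length = N → p.edges.toFinset ∈ P) ∧
      ∑ γ ∈ P, q ^ γ.card ≤ ε := by
  classical
  set S := ∑' n : ℕ, (n : ℝ) / φ n with hS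
  obtain ⟨n, hn⟩ := exists_pow_lt_of_lt_one (y := (1 / 2 : ℝ))
    (div_pos hε (Real.exp_pos (2 * S))) (by norm_num)
  obtain ⟨N, hN, hgood⟩ := hG.exists_radius hφ1 hφmono u n
  obtain ⟨T, hT, hTsum⟩ := G.exists_finset_walks_sum_exp_le N u
  set T' := T.filter fun p => p.2.IsPath with hT'
  refine ⟨N, T'.image fun p => p.2.edges.toFinset, ?_, ?_⟩
  · intro w p hp hl
    exact Finset.mem_image.2 ⟨⟨w, p⟩, by simp [hT', hT, hp, hl], rfl⟩
  have hw : ∀ p ∈ T', Real.exp (-(S * (3 * N + 2))) ≤ Real.exp (-p.2.degreeSum) := by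
    rintro ⟨w, p⟩ hp
    simp only [hT', Finset.mem_filter, hT] at hp
    refine Real.exp_le_exp.2 (neg_le_neg ?_)
    rw [← hp.1]
    refine hp.2.degreeSum_le hφ1 hφmono hφsum hG fun x hx => ?_
    simp only [hp.1]
    refine hgood x ⟨p.takeUntil x hx⟩ ((dist_le (p.takeUntil x hx)).trans ?_)
    rw [← hp.1]
    exact p.length_takeUntil_le_length hx
  have hcard : (T'.card : ℝ) * Real.exp (-(S * (3 * N + 2))) ≤ 1 := by
    rw [← nsmul_eq_mul, ← Finset.sum_const]
    refine (Finset.sum_le_sum hw).trans (le_trans ?_ hTsum)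
    exact Finset.sum_le_sum_of_subset_of_nonneg (Finset.filter_subset _ _)
      fun _ _ _ => (Real.exp_pos _).le
  calc ∑ γ ∈ T'.image (fun p => p.2.edges.toFinset), q ^ γ.card
      ≤ ∑ p ∈ T', q ^ (p.2.edges.toFinset).card :=
        Finset.sum_image_le_of_nonneg (f := fun γ : Finset (Sym2 V) => q ^ γ.card)
          fun _ _ => pow_nonneg hq0 _
    _ = T'.card * q ^ N := by
        rw [← nsmul_eq_mul, ← Finset.sum_const]
        refine Finset.sum_congr rfl ?_
        rintro ⟨w, p⟩ hp
        simp only [hT', Finset.mem_filter, hT] at hp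
        rw [List.toFinset_card_of_nodup hp.2.isTrail.edges_nodup, Walk.length_edges, hp.1]
    _ ≤ T'.card * (Real.exp (-(3 * S)) / 2) ^ N := by gcongr
    _ = (T'.card * Real.exp (-(S * (3 * N + 2)))) * (Real.exp (2 * S) * (1 / 2) ^ N) := by
        have : Real.exp (-(3 * S)) ^ N = Real.exp (-(S * (3 * N + 2))) * Real.exp (2 * S) := by
          rw [← Real.exp_nat_mul, ← Real.exp_add]
          ring_nf
        rw [div_pow, this, one_div, inv_pow]
        ring
    _ ≤ 1 * (Real.exp (2 * S) * (1 / 2) ^ N) := by gcongr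
    _ ≤ Real.exp (2 * S) * (1 / 2) ^ n := by
        rw [one_mul]
        gcongr ?_ * ?_
        exact pow_le_pow_of_le_one (by norm_num) (by norm_num) hN
    _ ≤ ε := by
        rw [lt_div_iff₀ (Real.exp_pos _)] at hn
        linarith

lemma sum_biUnion_le_sum {ι α : Type*} [DecidableEq α] {s : Finset ι} {t : ι → Finset α}
    {f : α → ℝ} (hf : ∀ a, 0 ≤ f a) : ∑ a ∈ s.biUnion t, f a ≤ ∑ i ∈ s, ∑ a ∈ t i, f a := by
  classical
  rw [Finset.sum_sigma' s t fun _ a => f a]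
  have : s.biUnion t = (s.sigma t).image Sigma.snd := by
    ext a
    simp
  rw [this]
  exact Finset.sum_image_le_of_nonneg fun _ _ => hf _

/-- Around a finite set `Λ₀` there is a finite volume `Λ` and a family `P` of bond sets of small
total weight such that every bond configuration containing no member of `P` has its clusters
meeting `Λ₀` confined to `Λ`. -/
lemma DegreeSeparated.exists_volume (hφ1 : ∀ n, 1 ≤ φ n) (hφmono : Monotone φ)
    (hφsum : Summable fun n : ℕ => (n : ℝ) / φ n) (hG : G.DegreeSeparated φ)
    [DecidableEq V] {q : ℝ} (hq0 : 0 ≤ q)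
    (hq : q ≤ Real.exp (-(3 * ∑' n : ℕ, (n : ℝ) / φ n)) / 2) {ε : ℝ} (hε : 0 < ε)
    (Λ₀ : Finset V) :
    ∃ (Λ : Finset V) (P : Finset (Finset (Sym2 V))), Λ₀ ⊆ Λ ∧ ∑ γ ∈ P, q ^ γ.card ≤ ε ∧
      ∀ A : Finset (Sym2 V), (∀ e ∈ A, e ∈ G.edgeSet) → (∀ γ ∈ P, ¬ γ ⊆ A) →
        ∃ C : Set V, ↑Λ₀ ⊆ C ∧ C ⊆ ↑Λ ∧ ∀ e ∈ A, ∀ a ∈ e, ∀ b ∈ e, (a ∈ C ↔ b ∈ C) := by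
  classical
  have hε' : 0 < ε / (Λ₀.card + 1) := by positivity
  choose N P hP hPsum using fun u => hG.exists_paths hφ1 hφmono hφsum hq0 hq hε' u
  choose T hT _ using fun n u => G.exists_finset_walks_sum_exp_le n u
  let ball : V → Finset V := fun u =>
    (Finset.range (N u + 1)).biUnion fun n => (T n u).image Sigma.fst
  have hball : ∀ {u w : V} (p : G.Walk u w), p.length ≤ N u → w ∈ ball u := by
    intro u w p hp
    simp only [ball, Finset.mem_biUnion, Finset.mem_range, Finset.mem_image]
    exact ⟨p.length, by omega, ⟨w, p⟩, (hT _ _ _).2 rfl, rfl⟩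
  refine ⟨Λ₀.biUnion ball, Λ₀.biUnion P, ?_, ?_, ?_⟩
  · intro u hu
    exact Finset.mem_biUnion.2 ⟨u, hu, hball Walk.nil (by simp)⟩
  · calc ∑ γ ∈ Λ₀.biUnion P, q ^ γ.card ≤ ∑ u ∈ Λ₀, ∑ γ ∈ P u, q ^ γ.card :=
          sum_biUnion_le_sum fun _ => pow_nonneg hq0 _
      _ ≤ ∑ u ∈ Λ₀, ε / (Λ₀.card + 1) := Finset.sum_le_sum fun u _ => hPsum u
      _ ≤ ε := by
        rw [Finset.sum_const, nsmul_eq_mul, mul_div_assoc', div_le_iff₀ (by positivity)]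
        nlinarith
  · intro A hA hPA
    have hle : fromEdgeSet (A : Set (Sym2 V)) ≤ G := by
      intro a b hab
      rw [fromEdgeSet_adj] at hab
      exact hA _ hab.1
    refine ⟨{x | ∃ u ∈ Λ₀, (fromEdgeSet (A : Set (Sym2 V))).Reachable u x}, ?_, ?_, ?_⟩
    · exact fun u hu => ⟨u, hu, Reachable.refl _⟩
    · rintro x ⟨u, hu, hux⟩
      obtain ⟨p, hp⟩ := hux.exists_isPath
      refine Finset.mem_coe.2 (Finset.mem_biUnion.2 ⟨u, hu, ?_⟩)
      by_contra hx
      have hlen : N u < (p.mapLe hle).length := by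
        by_contra h
        exact hx (hball _ (not_lt.1 h))
      have hp' : (p.mapLe hle).IsPath := hp.mapLe hle
      refine hPA _ (Finset.mem_biUnion.2 ⟨u, hu,
        hP u _ ((p.mapLe hle).take (N u)) (hp'.take _) ?_⟩) ?_
      · rw [Walk.take_length]
        omega
      · intro e he
        rw [List.mem_toFinset, Walk.edges_take] at he
        have he' := List.mem_of_mem_take he
        rw [Walk.edges_mapLe_eq_edges] at he'
        have := p.edges_subset_edgeSet he'
        rw [edgeSet_fromEdgeSet] at this
        exact this.1
    · intro e he a ha b hb
      by_cases hab : a = b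
      · rw [hab]
      have he' : e = s(a, b) := (Sym2.mem_and_mem_iff hab).1 ⟨ha, hb⟩
      have hadj : (fromEdgeSet (A : Set (Sym2 V))).Adj a b := by
        rw [fromEdgeSet_adj]
        exact ⟨he' ▸ he, hab⟩
      constructor
      · rintro ⟨u, hu, h⟩
        exact ⟨u, hu, h.trans hadj.reachable⟩
      · rintro ⟨u, hu, h⟩
        exact ⟨u, hu, h.trans hadj.symm.reachable⟩

end SimpleGraph

noncomputable section

namespace SimpleGraph

variable {V : Type*} [DecidableEq V] (G : SimpleGraph V) [DecidableRel G.Adj] [G.LocallyFinite]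

/-- The edges having at least one endpoint in `Λ`. -/
def bonds (Λ : Finset V) : Finset (Sym2 V) :=
  Λ.biUnion fun a => G.incidenceFinset a

variable {G}

lemma mem_bonds {Λ : Finset V} {e : Sym2 V} :
    e ∈ G.bonds Λ ↔ e ∈ G.edgeSet ∧ ∃ a ∈ Λ, a ∈ e := by
  simp only [bonds, Finset.mem_biUnion, mem_incidenceFinset, incidenceSet, Set.mem_ofPred_eq]
  tauto

lemma bonds_mono {Λ Λ' : Finset V} (h : Λ ⊆ Λ') : G.bonds Λ ⊆ G.bonds Λ' :=
  Finset.biUnion_subset_biUnion_of_subset_left _ h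

lemma sum_bonds (Λ : Finset V) (g : Sym2 V → ℝ) :
    ∑ e ∈ G.bonds Λ, g e =
      (1 / 2) * ∑ a ∈ Λ, ∑ b ∈ Λ, (if G.Adj a b then g s(a, b) else 0) +
        ∑ a ∈ Λ, ∑ b ∈ G.neighborFinset a \ Λ, g s(a, b) := by
  induction Λ using Finset.induction_on with
  | empty => simp [bonds]
  | insert c Λ hc ih =>
    have hb : G.bonds (insert c Λ) =
        G.bonds Λ ∪ (G.neighborFinset c \ Λ).image fun b => s(c, b) := by
      ext e
      induction e using Sym2.ind with
      | _ x y =>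
        simp only [mem_bonds, mem_edgeSet, Finset.mem_insert, Sym2.mem_iff, Finset.mem_union,
          Finset.mem_image, Finset.mem_sdiff, mem_neighborFinset, Sym2.eq_iff]
        constructor
        · rintro ⟨h, a, rfl | ha, hxy⟩
          · rcases hxy with rfl | rfl
            · by_cases hy : y ∈ Λ
              · exact Or.inl ⟨h, y, hy, Or.inr rfl⟩
              · exact Or.inr ⟨y, ⟨h, hy⟩, Or.inl ⟨rfl, rfl⟩⟩
            · by_cases hx : x ∈ Λ
              · exact Or.inl ⟨h, x, hx, Or.inl rfl⟩
              · exact Or.inr ⟨x, ⟨h.symm, hx⟩, Or.inr ⟨rfl, rfl⟩⟩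
          · exact Or.inl ⟨h, a, ha, hxy⟩
        · rintro (⟨h, a, ha, hxy⟩ | ⟨b, ⟨h, -⟩, ⟨rfl, rfl⟩ | ⟨rfl, rfl⟩⟩)
          · exact ⟨h, a, Or.inr ha, hxy⟩
          · exact ⟨h, c, Or.inl rfl, Or.inl rfl⟩
          · exact ⟨h.symm, c, Or.inl rfl, Or.inr rfl⟩
    have hdisj : Disjoint (G.bonds Λ) ((G.neighborFinset c \ Λ).image fun b => s(c, b)) := by
      rw [Finset.disjoint_left]
      intro e he he'
      obtain ⟨b, hb', rfl⟩ := Finset.mem_image.1 he'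
      obtain ⟨-, a, ha, hab⟩ := mem_bonds.1 he
      rcases Sym2.mem_iff.1 hab with rfl | rfl
      · exact hc ha
      · exact (Finset.mem_sdiff.1 hb').2 ha
    rw [hb, Finset.sum_union hdisj, Finset.sum_image (by
      intro x _ y _ h
      rcases Sym2.eq_iff.1 h with h | h
      · exact h.2
      · exact h.2.trans h.1), ih]
    have hQ : ∀ a ∈ Λ, ∑ b ∈ G.neighborFinset a \ Λ, g s(a, b) =
        ∑ b ∈ G.neighborFinset a \ insert c Λ, g s(a, b) +
          if G.Adj a c then g s(a, c) else 0 := by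
      intro a _
      split_ifs with h
      · have : G.neighborFinset a \ Λ = insert c (G.neighborFinset a \ insert c Λ) := by
          ext b
          simp only [Finset.mem_sdiff, mem_neighborFinset, Finset.mem_insert]
          constructor
          · rintro ⟨h1, h2⟩
            by_cases hbc : b = c
            · exact Or.inl hbc
            · exact Or.inr ⟨h1, by tauto⟩
          · rintro (rfl | ⟨h1, h2⟩)
            · exact ⟨h, hc⟩
            · exact ⟨h1, by tauto⟩
        rw [this, Finset.sum_insert (by simp), add_comm]
      · rw [add_zero]
        refine Finset.sum_congr ?_ fun _ _ => rfl
        ext b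
        simp only [Finset.mem_sdiff, mem_neighborFinset, Finset.mem_insert, not_or]
        constructor
        · rintro ⟨h1, h2⟩
          refine ⟨h1, ?_, h2⟩
          rintro rfl
          exact h h1
        · tauto
    have hc' : G.neighborFinset c \ insert c Λ = G.neighborFinset c \ Λ := by
      ext b
      simp only [Finset.mem_sdiff, mem_neighborFinset, Finset.mem_insert, not_or]
      constructor
      · tauto
      · rintro ⟨h1, h2⟩
        exact ⟨h1, h1.ne', h2⟩
    have hsymm : ∀ a, (if G.Adj c a then g s(c, a) else 0) =
        if G.Adj a c then g s(a, c) else 0 := by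
      intro a
      simp only [Sym2.eq_swap, G.adj_comm]
    rw [Finset.sum_congr rfl hQ]
    simp only [Finset.sum_insert hc, Finset.sum_add_distrib, hc', hsymm, G.irrefl, if_false]
    ring

end SimpleGraph

section Loop

variable {M : Type*} [MetricSpace M] [CompactSpace M]

lemma isClosed_loop : IsClosed {x : C(unitInterval, M) | x 0 = x 1} :=
  isClosed_eq (by fun_prop) (by fun_prop)

instance : PolishSpace (Loop M) :=
  (isClosed_loop (M := M)).polishSpace

instance : SecondCountableTopology (Loop M) :=
  inferInstanceAs (SecondCountableTopology {x : C(unitInterval, M) // x 0 = x 1})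

lemma continuous_pathV (v : C(M × M, ℝ)) :
    Continuous fun p : Loop M × Loop M => pathV v p.1 p.2 := by
  refine continuous_of_dominated (bound := fun _ => ‖v‖) ?_ ?_ (integrable_const _) ?_
  · intro p
    have : Continuous fun τ => v (p.1.path τ, p.2.path τ) := by fun_prop
    exact this.aestronglyMeasurable
  · exact fun p => .of_forall fun τ => v.norm_coe_le_norm _
  · refine .of_forall fun τ => v.continuous.comp ?_
    have h : Continuous fun x : Loop M => x.path τ :=
      (continuous_eval_const τ).comp continuous_subtype_val
    exact (h.comp continuous_fst).prodMk (h.comp continuous_snd)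

lemma abs_pathV_le (v : C(M × M, ℝ)) (x y : Loop M) : |pathV v x y| ≤ ‖v‖ := by
  have := norm_integral_le_of_norm_le_const (μ := (volume : Measure unitInterval)) (C := ‖v‖)
    (f := fun τ => v (x.path τ, y.path τ)) (.of_forall fun τ => v.norm_coe_le_norm _)
  simpa [pathV] using this

lemma pathV_comm {v : C(M × M, ℝ)} (hv : ∀ ξ η, v (ξ, η) = v (η, ξ)) (x y : Loop M) :
    pathV v x y = pathV v y x := by
  simp only [pathV]
  congr 1
  ext τ
  exact hv _ _

variable {L : Type*} (v : L → L → C(M × M, ℝ))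

/-- The interaction along the bond `e` in the configuration `z`. -/
def bondV (z : L → Loop M) (e : Sym2 L) : ℝ :=
  pathV (v (Quot.out e).1 (Quot.out e).2) (z (Quot.out e).1) (z (Quot.out e).2)

/-- The total interaction along the bonds in `A`. -/
def energy (A : Finset (Sym2 L)) (z : L → Loop M) : ℝ :=
  ∑ e ∈ A, bondV v z e

/-- The supremum norm of the interaction along the bond `e`. -/
def bondNorm (e : Sym2 L) : ℝ := ‖v (Quot.out e).1 (Quot.out e).2‖

lemma out_mem_left (e : Sym2 L) : (Quot.out e).1 ∈ e := by
  have h : s((Quot.out e).1, (Quot.out e).2) = e := Quot.out_eq e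
  exact h.subst (motive := fun e' => (Quot.out e).1 ∈ e') (Sym2.mem_mk_left _ _)

lemma out_mem_right (e : Sym2 L) : (Quot.out e).2 ∈ e := by
  have h : s((Quot.out e).1, (Quot.out e).2) = e := Quot.out_eq e
  exact h.subst (motive := fun e' => (Quot.out e).2 ∈ e') (Sym2.mem_mk_right _ _)

variable {v}

lemma bondV_mk (hv : ∀ ℓ ℓ', v ℓ ℓ' = v ℓ' ℓ)
    (hv' : ∀ ℓ ℓ' (ξ η : M), v ℓ ℓ' (ξ, η) = v ℓ ℓ' (η, ξ)) (z : L → Loop M) (a b : L) :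
    bondV v z s(a, b) = pathV (v a b) (z a) (z b) := by
  have h : s((Quot.out s(a, b)).1, (Quot.out s(a, b)).2) = s(a, b) := Quot.out_eq s(a, b)
  rw [bondV]
  rcases Sym2.eq_iff.1 h with ⟨h1, h2⟩ | ⟨h1, h2⟩
  · rw [h1, h2]
  · rw [h1, h2, hv b a, pathV_comm (hv' a b)]

lemma bondNorm_nonneg (e : Sym2 L) : 0 ≤ bondNorm v e := norm_nonneg _

lemma abs_bondV_le (z : L → Loop M) (e : Sym2 L) : |bondV v z e| ≤ bondNorm v e :=
  abs_pathV_le _ _ _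

lemma bondV_congr {z z' : L → Loop M} {e : Sym2 L} (h : ∀ a ∈ e, z a = z' a) :
    bondV v z e = bondV v z' e := by
  rw [bondV, bondV, h _ (out_mem_left e), h _ (out_mem_right e)]

lemma continuous_bondV (e : Sym2 L) : Continuous fun z : L → Loop M => bondV v z e := by
  have h : Continuous fun z : L → Loop M => (z (Quot.out e).1, z (Quot.out e).2) :=
    (continuous_apply _).prodMk (continuous_apply _)
  exact (continuous_pathV (v (Quot.out e).1 (Quot.out e).2)).comp h

lemma continuous_energy (A : Finset (Sym2 L)) :
    Continuous fun z : L → Loop M => energy v A z :=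
  continuous_finsetSum _ fun e _ => continuous_bondV e

lemma abs_energy_le (A : Finset (Sym2 L)) (z : L → Loop M) :
    |energy v A z| ≤ ∑ e ∈ A, bondNorm v e :=
  (Finset.abs_sum_le_sum_abs _ _).trans (Finset.sum_le_sum fun e _ => abs_bondV_le z e)

lemma energy_congr {A : Finset (Sym2 L)} {z z' : L → Loop M}
    (h : ∀ e ∈ A, ∀ a ∈ e, z a = z' a) : energy v A z = energy v A z' :=
  Finset.sum_congr rfl fun e he => bondV_congr (h e he)

variable [DecidableEq L]

lemma glue_of_mem {Λ : Finset L} {x : Λ → Loop M} {y : L → Loop M} {a : L} (h : a ∈ Λ) :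
    Λ.glue x y a = x ⟨a, h⟩ := dif_pos h

lemma glue_of_notMem {Λ : Finset L} {x : Λ → Loop M} {y : L → Loop M} {a : L} (h : a ∉ Λ) :
    Λ.glue x y a = y a := dif_neg h

@[simp]
lemma glue_glue (Λ : Finset L) (x x' : Λ → Loop M) (y : L → Loop M) :
    Λ.glue x (Λ.glue x' y) = Λ.glue x y := by
  ext1 a
  by_cases h : a ∈ Λ
  · rw [glue_of_mem h, glue_of_mem h]
  · rw [glue_of_notMem h, glue_of_notMem h, glue_of_notMem h]

lemma continuous_glue (Λ : Finset L) :
    Continuous fun p : (Λ → Loop M) × (L → Loop M) => Λ.glue p.1 p.2 := by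
  refine continuous_pi fun a => ?_
  by_cases h : a ∈ Λ
  · simp only [glue_of_mem h]
    fun_prop
  · simp only [glue_of_notMem h]
    fun_prop

lemma measurable_glue (Λ : Finset L) :
    Measurable fun p : (Λ → Loop M) × (L → Loop M) => Λ.glue p.1 p.2 := by
  refine measurable_pi_iff.2 fun a => ?_
  by_cases h : a ∈ Λ
  · simp only [glue_of_mem h]
    fun_prop
  · simp only [glue_of_notMem h]
    fun_prop

variable {G : SimpleGraph L} [DecidableRel G.Adj] [G.LocallyFinite]

lemma condV_eq_energy (hv : ∀ ℓ ℓ', v ℓ ℓ' = v ℓ' ℓ)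
    (hv' : ∀ ℓ ℓ' (ξ η : M), v ℓ ℓ' (ξ, η) = v ℓ ℓ' (η, ξ)) (Λ : Finset L)
    (x : Λ → Loop M) (y : L → Loop M) :
    condV G v Λ x y = energy v (G.bonds Λ) (Λ.glue x y) := by
  rw [energy, G.sum_bonds, condV]
  simp only [bondV_mk hv hv']
  rw [← Finset.sum_coe_sort Λ, ← Finset.sum_coe_sort Λ]
  congr 1
  · congr 1
    refine Finset.sum_congr rfl fun a _ => ?_
    rw [← Finset.sum_coe_sort Λ]
    refine Finset.sum_congr rfl fun b _ => ?_
    rw [glue_of_mem a.2, glue_of_mem b.2]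
  · refine Finset.sum_congr rfl fun a _ => Finset.sum_congr rfl fun b hb => ?_
    rw [glue_of_mem a.2, glue_of_notMem (Finset.mem_sdiff.1 hb).2]

end Loop

section Kernel

variable {M : Type*} [MetricSpace M] [CompactSpace M] {L : Type*} [Countable L] [DecidableEq L]
  {G : SimpleGraph L} [DecidableRel G.Adj] [G.LocallyFinite] {χ : L → Measure (Loop M)}
  {v : L → L → C(M × M, ℝ)}

/-- The Boltzmann weight `exp V_Λ(x | y)`. -/
def weight (G : SimpleGraph L) [DecidableRel G.Adj] [G.LocallyFinite] (v : L → L → C(M × M, ℝ))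
    (Λ : Finset L) (y : L → Loop M) (x : Λ → Loop M) : ℝ :=
  Real.exp (energy v (G.bonds Λ) (Λ.glue x y))

lemma weight_pos (Λ : Finset L) (y : L → Loop M) (x : Λ → Loop M) : 0 < weight G v Λ y x :=
  Real.exp_pos _

lemma weight_le (Λ : Finset L) (y : L → Loop M) (x : Λ → Loop M) :
    weight G v Λ y x ≤ Real.exp (∑ e ∈ G.bonds Λ, bondNorm v e) :=
  Real.exp_le_exp.2 (abs_le.1 (abs_energy_le _ _)).2

lemma le_weight (Λ : Finset L) (y : L → Loop M) (x : Λ → Loop M) :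
    Real.exp (-∑ e ∈ G.bonds Λ, bondNorm v e) ≤ weight G v Λ y x :=
  Real.exp_le_exp.2 (abs_le.1 (abs_energy_le _ _)).1

lemma measurable_uncurry_weight (Λ : Finset L) :
    Measurable fun p : (Λ → Loop M) × (L → Loop M) => weight G v Λ p.2 p.1 :=
  Real.measurable_exp.comp ((continuous_energy _).measurable.comp (measurable_glue Λ))

lemma continuous_uncurry_weight (Λ : Finset L) :
    Continuous fun p : (Λ → Loop M) × (L → Loop M) => weight G v Λ p.2 p.1 :=
  Real.continuous_exp.comp ((continuous_energy _).comp (continuous_glue Λ))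

lemma measurable_glue_left (Λ : Finset L) (y : L → Loop M) :
    Measurable fun x : Λ → Loop M => Λ.glue x y :=
  (measurable_glue Λ).comp (measurable_prodMk_right (y := y))

lemma measurable_weight (Λ : Finset L) (y : L → Loop M) : Measurable (weight G v Λ y) :=
  Real.measurable_exp.comp ((continuous_energy _).measurable.comp (measurable_glue_left Λ y))

section

variable [∀ ℓ, IsProbabilityMeasure (χ ℓ)]

instance (Λ : Finset L) : IsProbabilityMeasure (chiProd χ Λ) := by
  unfold chiProd
  infer_instance

lemma integrable_weight_mul (Λ : Finset L) (y : L → Loop M) {f : (L → Loop M) → ℝ}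
    (hf : Measurable f) {K : ℝ} (hK : ∀ z, |f z| ≤ K) :
    Integrable (fun x => weight G v Λ y x * f (Λ.glue x y)) (chiProd χ Λ) := by
  refine Integrable.of_bound (C := Real.exp (∑ e ∈ G.bonds Λ, bondNorm v e) * K)
    ((measurable_weight Λ y).mul (hf.comp (measurable_glue_left Λ y))).aestronglyMeasurable
    (.of_forall fun x => ?_)
  rw [Real.norm_eq_abs, abs_mul, abs_of_pos (weight_pos Λ y x)]
  exact mul_le_mul (weight_le Λ y x) (hK _) (abs_nonneg _) (Real.exp_pos _).le

lemma integrable_weight (Λ : Finset L) (y : L → Loop M) :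
    Integrable (weight G v Λ y) (chiProd χ Λ) := by
  simpa using integrable_weight_mul (χ := χ) (G := G) (v := v) Λ y (f := fun _ => 1)
    measurable_const (K := 1) (by simp)

lemma integral_weight_pos (Λ : Finset L) (y : L → Loop M) :
    0 < ∫ x, weight G v Λ y x ∂chiProd χ Λ := by
  have := integral_mono (integrable_const _) (integrable_weight (G := G) (v := v) (χ := χ) Λ y)
    (le_weight Λ y)
  rw [integral_const, probReal_univ, one_smul] at this
  exact (Real.exp_pos _).trans_le this

variable (hv : ∀ ℓ ℓ', v ℓ ℓ' = v ℓ' ℓ)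
  (hv' : ∀ ℓ ℓ' (ξ η : M), v ℓ ℓ' (ξ, η) = v ℓ ℓ' (η, ξ))

include hv hv'

lemma gibbsKernel_eq (Λ : Finset L) (y : L → Loop M) :
    gibbsKernel G χ v Λ y = ENNReal.ofReal (∫ x, weight G v Λ y x ∂chiProd χ Λ)⁻¹ •
      Measure.map (fun x => Λ.glue x y)
        ((chiProd χ Λ).withDensity fun x => ENNReal.ofReal (weight G v Λ y x)) := by
  rw [ENNReal.ofReal_inv_of_pos (integral_weight_pos Λ y),
    ofReal_integral_eq_lintegral_ofReal (integrable_weight Λ y)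
      (.of_forall fun x => (weight_pos Λ y x).le)]
  simp only [gibbsKernel, condV_eq_energy hv hv', weight]

lemma integral_gibbsKernel (Λ : Finset L) (y : L → Loop M) {f : (L → Loop M) → ℝ}
    (hf : Measurable f) :
    ∫ z, f z ∂gibbsKernel G χ v Λ y = (∫ x, weight G v Λ y x ∂chiProd χ Λ)⁻¹ *
      ∫ x, weight G v Λ y x * f (Λ.glue x y) ∂chiProd χ Λ := by
  rw [gibbsKernel_eq hv hv', integral_smul_measure,
    integral_map (measurable_glue_left Λ y).aemeasurable hf.aestronglyMeasurable,
    integral_withDensity_eq_integral_toReal_smul (measurable_weight Λ y).ennreal_ofReal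
      (.of_forall fun x => ENNReal.ofReal_lt_top),
    ENNReal.toReal_ofReal (inv_nonneg.2 (integral_weight_pos Λ y).le), smul_eq_mul]
  simp only [ENNReal.toReal_ofReal (weight_pos Λ y _).le, smul_eq_mul]

lemma isProbabilityMeasure_gibbsKernel (Λ : Finset L) (y : L → Loop M) :
    IsProbabilityMeasure (gibbsKernel G χ v Λ y) := by
  constructor
  have hZ := integral_weight_pos (G := G) (v := v) (χ := χ) Λ y
  rw [gibbsKernel_eq hv hv', Measure.smul_apply,
    Measure.map_apply (measurable_glue_left Λ y) .univ, Set.preimage_univ,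
    withDensity_apply _ .univ, Measure.restrict_univ,
    ← ofReal_integral_eq_lintegral_ofReal (integrable_weight Λ y)
      (.of_forall fun x => (weight_pos Λ y x).le), smul_eq_mul,
    ← ENNReal.ofReal_mul (inv_nonneg.2 hZ.le), inv_mul_cancel₀ hZ.ne', ENNReal.ofReal_one]

lemma measurable_gibbsKernel (Λ : Finset L) : Measurable (gibbsKernel G χ v Λ) := by
  refine Measure.measurable_of_measurable_coe _ fun B hB => ?_
  have h : ∀ y, gibbsKernel G χ v Λ y B =
      (∫⁻ x, ENNReal.ofReal (weight G v Λ y x) ∂chiProd χ Λ)⁻¹ *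
      ∫⁻ x, ENNReal.ofReal (weight G v Λ y x) * B.indicator 1 (Λ.glue x y) ∂chiProd χ Λ := by
    intro y
    simp only [gibbsKernel, condV_eq_energy hv hv', Measure.smul_apply, smul_eq_mul]
    rw [Measure.map_apply (measurable_glue_left Λ y) hB,
      withDensity_apply _ (measurable_glue_left Λ y hB),
      ← lintegral_indicator (measurable_glue_left Λ y hB)]
    congr 1
    refine lintegral_congr fun x => ?_
    by_cases hx : Λ.glue x y ∈ B
    · simp [hx, weight]
    · simp [hx]
  simp only [h]
  have hw := (measurable_uncurry_weight (G := G) (v := v) Λ).ennreal_ofReal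
  refine (Measurable.lintegral_prod_left' hw).inv.mul (Measurable.lintegral_prod_left'
    (f := fun p : (Λ → Loop M) × (L → Loop M) =>
      ENNReal.ofReal (weight G v Λ p.2 p.1) * B.indicator 1 (Λ.glue p.1 p.2)) (hw.mul ?_))
  exact (measurable_one.indicator hB).comp (measurable_glue Λ)

lemma integral_bind_gibbsKernel (Λ : Finset L) (μ : Measure (L → Loop M)) [IsFiniteMeasure μ]
    {f : (L → Loop M) → ℝ} (hf : Measurable f) {K : ℝ} (hK : ∀ z, |f z| ≤ K) :
    ∫ z, f z ∂μ.bind (gibbsKernel G χ v Λ) = ∫ y, ∫ z, f z ∂gibbsKernel G χ v Λ y ∂μ := by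
  let κ : ProbabilityTheory.Kernel (L → Loop M) (L → Loop M) :=
    ⟨gibbsKernel G χ v Λ, measurable_gibbsKernel hv hv' Λ⟩
  have : ProbabilityTheory.IsMarkovKernel κ :=
    ⟨fun y => isProbabilityMeasure_gibbsKernel hv hv' Λ y⟩
  have h := ProbabilityTheory.Kernel.integral_comp (κ := ProbabilityTheory.Kernel.const Unit μ)
    (η := κ) (a := ()) (f := f)
    (.of_bound hf.aestronglyMeasurable K (.of_forall fun z => hK z))
  rwa [ProbabilityTheory.Kernel.comp_apply] at h

lemma continuous_integral_gibbsKernel (Λ : Finset L) {f : (L → Loop M) → ℝ}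
    (hf : Continuous f) {K : ℝ} (hK : ∀ z, |f z| ≤ K) :
    Continuous fun y => ∫ z, f z ∂gibbsKernel G χ v Λ y := by
  simp only [integral_gibbsKernel hv hv' Λ _ hf.measurable]
  have hw : ∀ x : Λ → Loop M, Continuous fun y : L → Loop M => weight G v Λ y x := fun x =>
    (continuous_uncurry_weight Λ).comp (continuous_const.prodMk continuous_id)
  refine Continuous.mul (Continuous.inv₀ ?_ fun y => (integral_weight_pos Λ y).ne') ?_
  · refine continuous_of_dominated
      (bound := fun _ => Real.exp (∑ e ∈ G.bonds Λ, bondNorm v e))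
      (fun y => (measurable_weight Λ y).aestronglyMeasurable) (fun y => .of_forall fun x => ?_)
      (integrable_const _) (.of_forall hw)
    rw [Real.norm_eq_abs, abs_of_pos (weight_pos Λ y x)]
    exact weight_le Λ y x
  · refine continuous_of_dominated
      (bound := fun _ => Real.exp (∑ e ∈ G.bonds Λ, bondNorm v e) * K)
      (fun y => (integrable_weight_mul Λ y hf.measurable hK).aestronglyMeasurable)
      (fun y => .of_forall fun x => ?_) (integrable_const _) (.of_forall fun x => (hw x).mul
        (hf.comp ((continuous_glue Λ).comp (continuous_const.prodMk continuous_id))))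
    rw [Real.norm_eq_abs, abs_mul, abs_of_pos (weight_pos Λ y x)]
    exact mul_le_mul (weight_le Λ y x) (hK _) (abs_nonneg _) (Real.exp_pos _).le

end

end Kernel

section Expansion

lemma Finset.sum_powerset_superset_prod_le {α : Type*} [DecidableEq α] (E γ : Finset α)
    {F : α → ℝ} {q : ℝ} (hF : ∀ e, 0 ≤ F e) (hq0 : 0 ≤ q) (hq : ∀ e ∈ E, F e ≤ q) :
    ∑ A ∈ E.powerset with γ ⊆ A, ∏ e ∈ A, F e ≤ q ^ γ.card * ∏ e ∈ E, (1 + F e) := by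
  have hp : ∀ B : Finset α, 0 ≤ ∏ e ∈ B, (1 + F e) := fun B =>
    Finset.prod_nonneg fun e _ => by linarith [hF e]
  by_cases hγ : γ ⊆ E
  · have h : ∑ A ∈ E.powerset with γ ⊆ A, ∏ e ∈ A, F e =
        ∑ A ∈ (E \ γ).powerset, (∏ e ∈ γ, F e) * ∏ e ∈ A, F e := by
      refine Finset.sum_bij' (fun A _ => A \ γ) (fun A _ => γ ∪ A) ?_ ?_ ?_ ?_ ?_
      · intro A hA
        simp only [Finset.mem_filter, Finset.mem_powerset] at hA ⊢
        exact Finset.sdiff_subset_sdiff hA.1 le_rfl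
      · intro A hA
        simp only [Finset.mem_filter, Finset.mem_powerset] at hA ⊢
        exact ⟨Finset.union_subset hγ (hA.trans Finset.sdiff_subset), Finset.subset_union_left⟩
      · intro A hA
        exact Finset.union_sdiff_of_subset (Finset.mem_filter.1 hA).2
      · intro A hA
        refine Finset.union_sdiff_cancel_left ?_
        exact Finset.disjoint_of_subset_right (Finset.mem_powerset.1 hA) Finset.disjoint_sdiff
      · intro A hA
        rw [mul_comm, Finset.prod_sdiff (Finset.mem_filter.1 hA).2]
    rw [h, ← Finset.mul_sum, ← Finset.prod_one_add, ← Finset.prod_sdiff hγ,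
      mul_comm (∏ e ∈ E \ γ, _), ← mul_assoc]
    refine mul_le_mul_of_nonneg_right ?_ (hp _)
    calc ∏ e ∈ γ, F e ≤ ∏ e ∈ γ, q * (1 + F e) := by
          refine Finset.prod_le_prod (fun e _ => hF e) fun e he => ?_
          have := hq e (hγ he)
          nlinarith [hF e]
      _ = q ^ γ.card * ∏ e ∈ γ, (1 + F e) := by
          rw [Finset.prod_mul_distrib, Finset.prod_const]
  · rw [Finset.sum_eq_zero]
    · exact mul_nonneg (pow_nonneg hq0 _) (hp _)
    · intro A hA
      simp only [Finset.mem_filter, Finset.mem_powerset] at hA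
      exact absurd (hA.2.trans hA.1) hγ

lemma Finset.sum_powerset_exists_superset_prod_le {α : Type*} [DecidableEq α] (E : Finset α)
    (P : Finset (Finset α)) {F : α → ℝ} {q : ℝ} (hF : ∀ e, 0 ≤ F e) (hq0 : 0 ≤ q)
    (hq : ∀ e ∈ E, F e ≤ q) :
    ∑ A ∈ E.powerset with ¬ ∀ γ ∈ P, ¬ γ ⊆ A, ∏ e ∈ A, F e ≤
      (∑ γ ∈ P, q ^ γ.card) * ∏ e ∈ E, (1 + F e) := by
  have hp : ∀ B : Finset α, 0 ≤ ∏ e ∈ B, F e := fun B => Finset.prod_nonneg fun e _ => hF e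
  refine le_trans ?_ (((Finset.sum_le_sum fun γ _ =>
    Finset.sum_powerset_superset_prod_le E γ hF hq0 hq)).trans_eq (Finset.sum_mul _ _ _).symm)
  simp only [Finset.sum_filter]
  rw [Finset.sum_comm]
  refine Finset.sum_le_sum fun A _ => ?_
  have h0 : ∀ γ ∈ P, 0 ≤ if γ ⊆ A then ∏ e ∈ A, F e else 0 := fun γ _ => by
    split_ifs
    exacts [hp A, le_rfl]
  split_ifs with h
  · exact Finset.sum_nonneg h0
  · push Not at h
    obtain ⟨γ, hγ, h⟩ := h
    exact (if_pos h).ge.trans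
      (Finset.single_le_sum (f := fun γ => if γ ⊆ A then ∏ e ∈ A, F e else 0) h0 hγ)

end Expansion

section Swap

open Classical in
/-- Exchange the coordinates in `C` of two configurations. -/
def swapOn {ι α : Type*} (C : Set ι) (p : (ι → α) × (ι → α)) : (ι → α) × (ι → α) :=
  (fun a => if a ∈ C then p.2 a else p.1 a, fun a => if a ∈ C then p.1 a else p.2 a)

lemma measurePreserving_swapOn {ι α : Type*} [Fintype ι] [MeasurableSpace α] (μ : ι → Measure α)
    [∀ i, IsProbabilityMeasure (μ i)] (C : Set ι) :
    MeasurePreserving (swapOn C) ((Measure.pi μ).prod (Measure.pi μ))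
      ((Measure.pi μ).prod (Measure.pi μ)) := by
  classical
  have h := measurePreserving_arrowProdEquivProdArrow α α ι μ μ
  have h2 : MeasurePreserving (fun (g : ι → α × α) i => (if i ∈ C then Prod.swap else id) (g i))
      (Measure.pi fun i => (μ i).prod (μ i)) (Measure.pi fun i => (μ i).prod (μ i)) := by
    refine measurePreserving_pi _ _ fun i => ?_
    split_ifs
    · exact Measure.measurePreserving_swap
    · exact MeasurePreserving.id _
  have h3 := (h.comp h2).comp h.symm
  convert h3 using 1
  ext1 p
  refine Prod.ext ?_ ?_
  all_goals
    ext1 a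
    by_cases ha : a ∈ C <;>
      simp [swapOn, ha, MeasurableEquiv.arrowProdEquivProdArrow, Equiv.arrowProdEquivProdArrow]

end Swap

section Disagreement

variable {M : Type*} [MetricSpace M] [CompactSpace M] {L : Type*} [Countable L] [DecidableEq L]
  {G : SimpleGraph L} [DecidableRel G.Adj] [G.LocallyFinite] {χ : L → Measure (Loop M)}
  {v : L → L → C(M × M, ℝ)}

/-- The bond weight `exp (V_e(z) + V_e(z') + 2 ‖v_e‖) - 1` of a pair of configurations. -/
def pairWeight (v : L → L → C(M × M, ℝ)) (z z' : L → Loop M) (e : Sym2 L) : ℝ :=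
  Real.exp (bondV v z e + bondV v z' e + 2 * bondNorm v e) - 1

lemma pairWeight_nonneg (z z' : L → Loop M) (e : Sym2 L) : 0 ≤ pairWeight v z z' e := by
  have h1 := abs_le.1 (abs_bondV_le (v := v) z e)
  have h2 := abs_le.1 (abs_bondV_le (v := v) z' e)
  exact sub_nonneg.2 (Real.one_le_exp (by linarith))

lemma pairWeight_le (z z' : L → Loop M) (e : Sym2 L) :
    pairWeight v z z' e ≤ Real.exp (4 * bondNorm v e) - 1 := by
  have h1 := abs_le.1 (abs_bondV_le (v := v) z e)
  have h2 := abs_le.1 (abs_bondV_le (v := v) z' e)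
  exact sub_le_sub_right (Real.exp_le_exp.2 (by linarith)) _

lemma prod_one_add_pairWeight (A : Finset (Sym2 L)) (z z' : L → Loop M) :
    ∏ e ∈ A, (1 + pairWeight v z z' e) =
      Real.exp (2 * ∑ e ∈ A, bondNorm v e) *
        (Real.exp (energy v A z) * Real.exp (energy v A z')) := by
  simp only [pairWeight, add_sub_cancel]
  rw [← Real.exp_sum, ← Real.exp_add, ← Real.exp_add, Finset.sum_add_distrib,
    Finset.sum_add_distrib, ← Finset.mul_sum, energy, energy]
  ring_nf

lemma prod_pairWeight_le (A : Finset (Sym2 L)) (z z' : L → Loop M) :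
    ∏ e ∈ A, pairWeight v z z' e ≤ ∏ e ∈ A, (Real.exp (4 * bondNorm v e) - 1) :=
  Finset.prod_le_prod (fun e _ => pairWeight_nonneg z z' e) fun e _ => pairWeight_le z z' e

lemma measurable_pairWeight {α : Type*} [MeasurableSpace α] {f g : α → L → Loop M}
    (hf : Measurable f) (hg : Measurable g) (e : Sym2 L) :
    Measurable fun a => pairWeight v (f a) (g a) e :=
  (Real.measurable_exp.comp ((((continuous_bondV e).measurable.comp hf).add
    ((continuous_bondV e).measurable.comp hg)).add measurable_const)).sub measurable_const

variable [∀ ℓ, IsProbabilityMeasure (χ ℓ)]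

/-- Exchanging two configurations on a set `C ⊆ Λ` which is closed under the bonds in `A` shows
that those bonds do not carry any influence of the boundary condition into `C`. -/
lemma integral_sub_mul_prod_pairWeight_eq_zero {Λ₀ Λ : Finset L} {C : Set L}
    (hC₀ : ↑Λ₀ ⊆ C) (hC : C ⊆ ↑Λ) {A : Finset (Sym2 L)}
    (hA : ∀ e ∈ A, ∀ a ∈ e, ∀ b ∈ e, (a ∈ C ↔ b ∈ C)) {f : (L → Loop M) → ℝ}
    (hfm : Measurable f) (hf : ∀ z z' : L → Loop M, (∀ a ∈ Λ₀, z a = z' a) → f z = f z')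
    (y y' : L → Loop M) :
    ∫ p : (Λ → Loop M) × (Λ → Loop M), (f (Λ.glue p.1 y) - f (Λ.glue p.2 y')) *
      ∏ e ∈ A, pairWeight v (Λ.glue p.1 y) (Λ.glue p.2 y') e
        ∂(chiProd χ Λ).prod (chiProd χ Λ) = 0 := by
  set g : (Λ → Loop M) × (Λ → Loop M) → ℝ := fun p =>
    (f (Λ.glue p.1 y) - f (Λ.glue p.2 y')) *
      ∏ e ∈ A, pairWeight v (Λ.glue p.1 y) (Λ.glue p.2 y') e with hg
  let C' : Set Λ := {a | (a : L) ∈ C}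
  have hmp : MeasurePreserving (swapOn C') ((chiProd χ Λ).prod (chiProd χ Λ))
      ((chiProd χ Λ).prod (chiProd χ Λ)) := measurePreserving_swapOn (fun ℓ : Λ => χ ℓ) C'
  have h1 : ∀ p : (Λ → Loop M) × (Λ → Loop M), ∀ a ∈ C,
      Λ.glue (swapOn C' p).1 y a = Λ.glue p.2 y' a ∧
      Λ.glue (swapOn C' p).2 y' a = Λ.glue p.1 y a := by
    intro p a ha
    have hΛ : a ∈ Λ := hC ha
    have ha' : (⟨a, hΛ⟩ : Λ) ∈ C' := ha
    simp [glue_of_mem hΛ, swapOn, ha']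
  have h2 : ∀ p : (Λ → Loop M) × (Λ → Loop M), ∀ a ∉ C,
      Λ.glue (swapOn C' p).1 y a = Λ.glue p.1 y a ∧
      Λ.glue (swapOn C' p).2 y' a = Λ.glue p.2 y' a := by
    intro p a ha
    by_cases hΛ : a ∈ Λ
    · have ha' : (⟨a, hΛ⟩ : Λ) ∉ C' := ha
      simp [glue_of_mem hΛ, swapOn, ha']
    · simp [glue_of_notMem hΛ]
  have h3 : ∀ p, g (swapOn C' p) = -g p := by
    intro p
    simp only [hg]
    rw [hf _ (Λ.glue p.2 y') fun a ha => (h1 p a (hC₀ ha)).1,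
      hf _ (Λ.glue p.1 y) fun a ha => (h1 p a (hC₀ ha)).2, ← neg_mul, neg_sub]
    congr 1
    refine Finset.prod_congr rfl fun e he => ?_
    rw [pairWeight, pairWeight]
    by_cases hc : (Quot.out e).1 ∈ C
    · have hce : ∀ a ∈ e, a ∈ C := fun a ha => (hA e he _ (out_mem_left e) a ha).1 hc
      rw [bondV_congr fun a ha => (h1 p a (hce a ha)).1,
        bondV_congr fun a ha => (h1 p a (hce a ha)).2, add_comm (bondV v _ e)]
    · have hce : ∀ a ∈ e, a ∉ C := fun a ha => (hA e he _ (out_mem_left e) a ha).not.1 hc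
      rw [bondV_congr fun a ha => (h2 p a (hce a ha)).1,
        bondV_congr fun a ha => (h2 p a (hce a ha)).2]
  have h4 : Measurable g :=
    ((hfm.comp ((measurable_glue_left Λ y).comp measurable_fst)).sub
      (hfm.comp ((measurable_glue_left Λ y').comp measurable_snd))).mul
    (Finset.measurable_fun_prod _ fun e _ => measurable_pairWeight
      ((measurable_glue_left Λ y).comp measurable_fst)
      ((measurable_glue_left Λ y').comp measurable_snd) e)
  have h5 := integral_map (μ := (chiProd χ Λ).prod (chiProd χ Λ)) (f := g)
    hmp.measurable.aemeasurable h4.aestronglyMeasurable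
  rw [hmp.map_eq] at h5
  simp only [h3, integral_neg] at h5
  linarith

variable (hv : ∀ ℓ ℓ', v ℓ ℓ' = v ℓ' ℓ)
  (hv' : ∀ ℓ ℓ' (ξ η : M), v ℓ ℓ' (ξ, η) = v ℓ ℓ' (η, ξ))

include hv hv' in
/-- The influence of the boundary condition on the observables localised in `Λ₀` is bounded by the
total weight of the sets of bonds crossing `Λ \ Λ₀`. -/
lemma abs_integral_gibbsKernel_sub_le {Λ₀ Λ : Finset L} {P : Finset (Finset (Sym2 L))}
    (hP : ∀ A : Finset (Sym2 L), (∀ e ∈ A, e ∈ G.edgeSet) → (∀ γ ∈ P, ¬ γ ⊆ A) →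
      ∃ C : Set L, ↑Λ₀ ⊆ C ∧ C ⊆ ↑Λ ∧ ∀ e ∈ A, ∀ a ∈ e, ∀ b ∈ e, (a ∈ C ↔ b ∈ C))
    {q : ℝ} (hq0 : 0 ≤ q) (hq : ∀ e ∈ G.edgeSet, Real.exp (4 * bondNorm v e) - 1 ≤ q)
    {f : (L → Loop M) → ℝ} (hfm : Measurable f) (hf0 : ∀ z, 0 ≤ f z) (hf1 : ∀ z, f z ≤ 1)
    (hf : ∀ z z' : L → Loop M, (∀ a ∈ Λ₀, z a = z' a) → f z = f z') (y y' : L → Loop M) :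
    |∫ z, f z ∂gibbsKernel G χ v Λ y - ∫ z, f z ∂gibbsKernel G χ v Λ y'| ≤
      ∑ γ ∈ P, q ^ γ.card := by
  set ν := chiProd χ Λ with hν
  set E := G.bonds Λ with hE
  set S := ∑ γ ∈ P, q ^ γ.card with hS
  have hS0 : 0 ≤ S := Finset.sum_nonneg fun γ _ => pow_nonneg hq0 _
  set K := Real.exp (2 * ∑ e ∈ E, bondNorm v e) with hK
  have hKpos : 0 < K := Real.exp_pos _
  set F : (Λ → Loop M) × (Λ → Loop M) → Sym2 L → ℝ := fun p e =>
    pairWeight v (Λ.glue p.1 y) (Λ.glue p.2 y') e with hF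
  set D : (Λ → Loop M) × (Λ → Loop M) → ℝ := fun p => f (Λ.glue p.1 y) - f (Λ.glue p.2 y')
    with hD
  have hf' : ∀ z, |f z| ≤ 1 := fun z => abs_le.2 ⟨by linarith [hf0 z], hf1 z⟩
  have hD1 : ∀ p, |D p| ≤ 1 := fun p => abs_le.2
    ⟨by linarith [hf0 (Λ.glue p.1 y), hf1 (Λ.glue p.2 y')],
      by linarith [hf1 (Λ.glue p.1 y), hf0 (Λ.glue p.2 y')]⟩
  have hF0 : ∀ p e, 0 ≤ F p e := fun p e => pairWeight_nonneg _ _ e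
  have hDm : Measurable D :=
    (hfm.comp ((measurable_glue_left Λ y).comp measurable_fst)).sub
      (hfm.comp ((measurable_glue_left Λ y').comp measurable_snd))
  have hFm : ∀ e, Measurable fun p => F p e := fun e => measurable_pairWeight
      ((measurable_glue_left Λ y).comp measurable_fst)
      ((measurable_glue_left Λ y').comp measurable_snd) e
  have hHi : ∀ A : Finset (Sym2 L), Integrable (fun p => ∏ e ∈ A, F p e) (ν.prod ν) := fun A =>
    .of_bound (Finset.measurable_fun_prod _ fun e _ => hFm e).aestronglyMeasurable
      (∏ e ∈ A, (Real.exp (4 * bondNorm v e) - 1)) (.of_forall fun p => by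
        rw [Real.norm_eq_abs, abs_of_nonneg (Finset.prod_nonneg fun e _ => hF0 p e)]
        exact prod_pairWeight_le A _ _)
  have hDi : ∀ {h : (Λ → Loop M) × (Λ → Loop M) → ℝ}, Integrable h (ν.prod ν) →
      Integrable (fun p => D p * h p) (ν.prod ν) := fun hh =>
    hh.bdd_mul hDm.aestronglyMeasurable (.of_forall hD1)
  have hW : ∀ p : (Λ → Loop M) × (Λ → Loop M),
      ∏ e ∈ E, (1 + F p e) = K * (weight G v Λ y p.1 * weight G v Λ y' p.2) := fun p =>
    prod_one_add_pairWeight E _ _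
  set Z := ∫ x, weight G v Λ y x ∂ν with hZ
  set Z' := ∫ x, weight G v Λ y' x ∂ν with hZ'
  have hZpos : 0 < Z := integral_weight_pos Λ y
  have hZpos' : 0 < Z' := integral_weight_pos Λ y'
  have hWi : Integrable (fun p => ∏ e ∈ E, (1 + F p e)) (ν.prod ν) := by
    simp only [hW]
    exact ((integrable_weight Λ y).mul_prod (integrable_weight Λ y')).const_mul K
  have hWint : ∫ p, ∏ e ∈ E, (1 + F p e) ∂ν.prod ν = K * (Z * Z') := by
    simp only [hW, integral_const_mul]
    rw [integral_prod_mul]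
  have hDint : ∫ p, D p * ∏ e ∈ E, (1 + F p e) ∂ν.prod ν =
      K * ((∫ x, weight G v Λ y x * f (Λ.glue x y) ∂ν) * Z' -
        Z * ∫ x, weight G v Λ y' x * f (Λ.glue x y') ∂ν) := by
    rw [← integral_prod_mul, ← integral_prod_mul, ← integral_sub, ← integral_const_mul]
    · refine integral_congr_ae (.of_forall fun p => ?_)
      simp only [hW, hD]
      ring
    · exact (integrable_weight_mul Λ y hfm hf').mul_prod (integrable_weight Λ y')
    · exact (integrable_weight Λ y).mul_prod (integrable_weight_mul Λ y' hfm hf')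
  have hmain : |∫ p, D p * ∏ e ∈ E, (1 + F p e) ∂ν.prod ν| ≤ S * (K * (Z * Z')) := by
    have h1 : ∀ p, D p * ∏ e ∈ E, (1 + F p e) =
        ∑ A ∈ E.powerset with ∀ γ ∈ P, ¬ γ ⊆ A, D p * ∏ e ∈ A, F p e +
          D p * ∑ A ∈ E.powerset with ¬ ∀ γ ∈ P, ¬ γ ⊆ A, ∏ e ∈ A, F p e := by
      intro p
      rw [Finset.prod_one_add, ← Finset.mul_sum, ← mul_add, Finset.sum_filter_add_sum_filter_not]
    have h2 : ∫ p, ∑ A ∈ E.powerset with ∀ γ ∈ P, ¬ γ ⊆ A, D p * ∏ e ∈ A, F p e ∂ν.prod ν = 0 := by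
      rw [integral_finsetSum _ fun A _ => hDi (hHi A)]
      refine Finset.sum_eq_zero fun A hA => ?_
      simp only [Finset.mem_filter, Finset.mem_powerset] at hA
      obtain ⟨C, hC0, hC, hCA⟩ := hP A (fun e he => (SimpleGraph.mem_bonds.1 (hA.1 he)).1) hA.2
      exact integral_sub_mul_prod_pairWeight_eq_zero hC0 hC hCA hfm hf y y'
    simp only [h1]
    rw [integral_add (integrable_finsetSum _ fun A _ => hDi (hHi A))
      (hDi (integrable_finsetSum _ fun A _ => hHi A)), h2, zero_add, ← hWint,
      ← integral_const_mul]
    rw [← Real.norm_eq_abs]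
    refine norm_integral_le_of_norm_le (hWi.const_mul S) (.of_forall fun p => ?_)
    rw [Real.norm_eq_abs, abs_mul, abs_of_nonneg (a := ∑ A ∈ _, _)
      (Finset.sum_nonneg fun A _ => Finset.prod_nonneg fun e _ => hF0 p e)]
    refine (mul_le_of_le_one_left (Finset.sum_nonneg fun A _ => Finset.prod_nonneg
      fun e _ => hF0 p e) (hD1 p)).trans ?_
    exact Finset.sum_powerset_exists_superset_prod_le E P (hF0 p) hq0 fun e he =>
      (pairWeight_le _ _ e).trans (hq e (SimpleGraph.mem_bonds.1 he).1)
  rw [integral_gibbsKernel hv hv' Λ y hfm, integral_gibbsKernel hv hv' Λ y' hfm]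
  rw [hDint, abs_mul, abs_of_pos hKpos, mul_left_comm] at hmain
  have h3 := le_of_mul_le_mul_left hmain hKpos
  have h4 : Z⁻¹ * (∫ x, weight G v Λ y x * f (Λ.glue x y) ∂ν) -
      Z'⁻¹ * (∫ x, weight G v Λ y' x * f (Λ.glue x y') ∂ν) =
      ((∫ x, weight G v Λ y x * f (Λ.glue x y) ∂ν) * Z' -
        Z * ∫ x, weight G v Λ y' x * f (Λ.glue x y') ∂ν) / (Z * Z') := by
    field_simp
  rw [h4, abs_div, abs_of_pos (mul_pos hZpos hZpos'), div_le_iff₀ (mul_pos hZpos hZpos')]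
  exact h3

include hv hv' in
/-- Two measures satisfying the same DLR equation in `Λ` almost agree on observables localised in
`Λ₀`. -/
lemma abs_integral_sub_le_of_bind_eq {Λ : Finset L} {S : ℝ} {f : (L → Loop M) → ℝ}
    (hfm : Measurable f) (hf0 : ∀ z, 0 ≤ f z) (hf1 : ∀ z, f z ≤ 1)
    (hS : ∀ y y', |∫ z, f z ∂gibbsKernel G χ v Λ y - ∫ z, f z ∂gibbsKernel G χ v Λ y'| ≤ S)
    {μ μ' : Measure (L → Loop M)} [IsProbabilityMeasure μ] [IsProbabilityMeasure μ']
    (hμ : μ.bind (gibbsKernel G χ v Λ) = μ) (hμ' : μ'.bind (gibbsKernel G χ v Λ) = μ') :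
    |∫ z, f z ∂μ - ∫ z, f z ∂μ'| ≤ S := by
  have hf' : ∀ z, |f z| ≤ 1 := fun z => abs_le.2 ⟨by linarith [hf0 z], hf1 z⟩
  let κ : ProbabilityTheory.Kernel (L → Loop M) (L → Loop M) :=
    ⟨gibbsKernel G χ v Λ, measurable_gibbsKernel hv hv' Λ⟩
  have hκ : ProbabilityTheory.IsMarkovKernel κ :=
    ⟨fun y => isProbabilityMeasure_gibbsKernel hv hv' Λ y⟩
  set g : (L → Loop M) → ℝ := fun y => ∫ z, f z ∂gibbsKernel G χ v Λ y with hg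
  have hgm : StronglyMeasurable g := hfm.stronglyMeasurable.integral_kernel (κ := κ)
  have hg1 : ∀ y, |g y| ≤ 1 := fun y => by
    have := isProbabilityMeasure_gibbsKernel (G := G) (χ := χ) hv hv' Λ y
    have h := norm_integral_le_of_norm_le_const (μ := gibbsKernel G χ v Λ y) (f := f)
      (.of_forall hf')
    simpa using h
  have hgi : ∀ (ρ : Measure (L → Loop M)) [IsProbabilityMeasure ρ], Integrable g ρ := fun ρ _ =>
    .of_bound hgm.aestronglyMeasurable 1 (.of_forall hg1)
  have hsub : ∀ (ρ : Measure (L → Loop M)) [IsProbabilityMeasure ρ] (h : (L → Loop M) → ℝ) (a : ℝ),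
      Integrable h ρ → (∀ y, |h y - a| ≤ S) → |∫ y, h y ∂ρ - a| ≤ S := by
    intro ρ _ h a hi hb
    have h1 := norm_integral_le_of_norm_le_const (μ := ρ) (f := fun y => h y - a) (.of_forall hb)
    rw [integral_sub hi (integrable_const _)] at h1
    simpa using h1
  have h1 : ∫ z, f z ∂μ = ∫ y, g y ∂μ := by
    conv_lhs => rw [← hμ]
    exact integral_bind_gibbsKernel hv hv' Λ μ hfm hf'
  have h2 : ∫ z, f z ∂μ' = ∫ y, g y ∂μ' := by
    conv_lhs => rw [← hμ']
    exact integral_bind_gibbsKernel hv hv' Λ μ' hfm hf'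
  rw [h1, h2]
  refine hsub μ g _ (hgi μ) fun y => ?_
  rw [abs_sub_comm]
  exact hsub μ' g _ (hgi μ') fun y' => hS y' y

end Disagreement

section Uniqueness

variable {M : Type*} [MetricSpace M] [CompactSpace M] {L : Type*} [Countable L] [DecidableEq L]
  {G : SimpleGraph L} [DecidableRel G.Adj] [G.LocallyFinite] {χ : L → Measure (Loop M)}
  {v : L → L → C(M × M, ℝ)} [∀ ℓ, IsProbabilityMeasure (χ ℓ)]

lemma IsGibbs.eq (hv : ∀ ℓ ℓ', v ℓ ℓ' = v ℓ' ℓ)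
    (hv' : ∀ ℓ ℓ' (ξ η : M), v ℓ ℓ' (ξ, η) = v ℓ ℓ' (η, ξ)) {q : ℝ} (hq0 : 0 ≤ q)
    (hq : ∀ e ∈ G.edgeSet, Real.exp (4 * bondNorm v e) - 1 ≤ q)
    (hvol : ∀ (Λ₀ : Finset L) (ε : ℝ), 0 < ε →
      ∃ (Λ : Finset L) (P : Finset (Finset (Sym2 L))), Λ₀ ⊆ Λ ∧ ∑ γ ∈ P, q ^ γ.card ≤ ε ∧
        ∀ A : Finset (Sym2 L), (∀ e ∈ A, e ∈ G.edgeSet) → (∀ γ ∈ P, ¬ γ ⊆ A) →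
          ∃ C : Set L, ↑Λ₀ ⊆ C ∧ C ⊆ ↑Λ ∧ ∀ e ∈ A, ∀ a ∈ e, ∀ b ∈ e, (a ∈ C ↔ b ∈ C))
    {μ μ' : Measure (L → Loop M)} (hμ : IsGibbs G χ v μ) (hμ' : IsGibbs G χ v μ') : μ = μ' := by
  have := hμ.1
  have := hμ'.1
  refine ext_of_generate_finite (measurableCylinders fun _ : L => Loop M)
    generateFrom_measurableCylinders.symm isPiSystem_measurableCylinders (fun s hs => ?_)
    (by simp)
  rcases isEmpty_or_nonempty L with hL | ⟨⟨ℓ⟩⟩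
  · rcases s.eq_empty_or_nonempty with rfl | hs
    · simp
    · rw [Subsingleton.eq_univ_of_nonempty hs, measure_univ, measure_univ]
  have hsm : MeasurableSet s := .of_mem_measurableCylinders hs
  obtain ⟨I, S, -, rfl⟩ := (mem_measurableCylinders _).1 hs
  rw [← measureReal_eq_measureReal_iff, ← integral_indicator_one hsm, ← integral_indicator_one hsm]
  refine eq_of_abs_sub_le_all fun ε hε => ?_
  obtain ⟨Λ, P, hΛ, hPε, hP⟩ := hvol (insert ℓ I) ε hε
  have hΛne : Λ.Nonempty := ⟨ℓ, hΛ (Finset.mem_insert_self _ _)⟩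
  have hm : Measurable ((cylinder I S).indicator (1 : (L → Loop M) → ℝ)) :=
    measurable_one.indicator hsm
  have h0 : ∀ z, 0 ≤ (cylinder I S).indicator (1 : (L → Loop M) → ℝ) z :=
    Set.indicator_nonneg fun _ _ => zero_le_one
  have h1 : ∀ z, (cylinder I S).indicator (1 : (L → Loop M) → ℝ) z ≤ 1 :=
    Set.indicator_le_self' (fun _ _ => zero_le_one)
  refine (abs_integral_sub_le_of_bind_eq hv hv' hm h0 h1
    (abs_integral_gibbsKernel_sub_le hv hv' hP hq0 hq hm h0 h1 fun z z' h => ?_)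
    (hμ.2 Λ hΛne) (hμ'.2 Λ hΛne)).trans hPε
  have : z ∈ cylinder I S ↔ z' ∈ cylinder I S := by
    have : I.restrict z = I.restrict z' := by
      ext1 a
      exact h a (Finset.mem_insert_of_mem a.2)
    rw [mem_cylinder, mem_cylinder, this]
  by_cases hz : z ∈ cylinder I S
  · rw [Set.indicator_of_mem hz, Set.indicator_of_mem (this.1 hz)]
    rfl
  · rw [Set.indicator_of_notMem hz, Set.indicator_of_notMem (this.not.1 hz)]

end Uniqueness

section Existence

open Filter Topology

variable {M : Type*} [MetricSpace M] [CompactSpace M] {L : Type*} [Countable L] [DecidableEq L]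
  {G : SimpleGraph L} [DecidableRel G.Adj] [G.LocallyFinite] {χ : L → Measure (Loop M)}
  {v : L → L → C(M × M, ℝ)} [∀ ℓ, IsProbabilityMeasure (χ ℓ)]

/-- Resampling the coordinates in `Λ` preserves the product measure. -/
lemma measurePreserving_glue (Λ : Finset L) :
    MeasurePreserving (fun p : (Λ → Loop M) × (L → Loop M) => Λ.glue p.1 p.2)
      ((chiProd χ Λ).prod (Measure.infinitePi χ)) (Measure.infinitePi χ) := by
  refine ⟨measurable_glue Λ, Measure.eq_infinitePi χ fun s t ht => ?_⟩
  rw [Measure.map_apply (measurable_glue Λ) (.pi s.countable_toSet fun i _ => ht i)]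
  have h : (fun p : (Λ → Loop M) × (L → Loop M) => Λ.glue p.1 p.2) ⁻¹' Set.pi s t =
      (Set.univ.pi fun a : Λ => if (a : L) ∈ s then t a else Set.univ) ×ˢ
        Set.pi ↑(s \ Λ) t := by
    ext p
    simp only [Set.mem_preimage, Set.mem_pi, Finset.mem_coe, Set.mem_prod, Set.mem_univ,
      true_implies, Finset.mem_sdiff]
    constructor
    · intro hp
      refine ⟨fun a => ?_, fun a ha => ?_⟩
      · split_ifs with has
        · simpa [glue_of_mem a.2] using hp a has
        · trivial
      · simpa [glue_of_notMem ha.2] using hp a ha.1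
    · rintro ⟨h1, h2⟩ a ha
      by_cases haΛ : a ∈ Λ
      · simpa [glue_of_mem haΛ, ha] using h1 ⟨a, haΛ⟩
      · simpa [glue_of_notMem haΛ] using h2 a ⟨ha, haΛ⟩
  rw [h, Measure.prod_prod, Measure.infinitePi_pi χ fun i _ => ht i, chiProd, Measure.pi_pi,
    ← Finset.prod_inter_mul_prod_sdiff s Λ]
  congr 1
  rw [Finset.prod_coe_sort Λ fun a => χ a (if a ∈ s then t a else Set.univ), Finset.inter_comm,
    ← Finset.filter_mem_eq_inter, Finset.prod_filter]
  refine Finset.prod_congr rfl fun a _ => ?_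
  split_ifs <;> simp

lemma integral_infinitePi_eq (Λ : Finset L) {h : (L → Loop M) → ℝ} (hm : Measurable h) {K : ℝ}
    (hK : ∀ z, |h z| ≤ K) :
    ∫ z, h z ∂Measure.infinitePi χ =
      ∫ z, ∫ x, h (Λ.glue x z) ∂chiProd χ Λ ∂Measure.infinitePi χ := by
  have hmp := measurePreserving_glue (χ := χ) Λ
  have h1 := integral_map (f := h) hmp.measurable.aemeasurable
    (hm.aestronglyMeasurable (μ := Measure.map (fun p : (Λ → Loop M) × (L → Loop M) =>
      Λ.glue p.1 p.2) ((chiProd χ Λ).prod (Measure.infinitePi χ))))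
  rw [hmp.map_eq] at h1
  rw [h1, integral_prod_symm]
  exact .of_bound (hm.comp hmp.measurable).aestronglyMeasurable K (.of_forall fun p => hK _)

/-- The product measure reweighted by the interactions along the bonds in `A`. -/
def bondMeasure (χ : L → Measure (Loop M)) (v : L → L → C(M × M, ℝ)) (A : Finset (Sym2 L)) :
    Measure (L → Loop M) :=
  (Measure.infinitePi χ).tilted (energy v A)

lemma integrable_exp_energy (A : Finset (Sym2 L)) :
    Integrable (fun z => Real.exp (energy v A z)) (Measure.infinitePi χ) :=
  .of_bound (Real.continuous_exp.comp (continuous_energy A)).measurable.aestronglyMeasurable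
    (Real.exp (∑ e ∈ A, bondNorm v e)) (.of_forall fun z => by
      rw [Real.norm_eq_abs, abs_of_pos (Real.exp_pos _)]
      exact Real.exp_le_exp.2 (abs_le.1 (abs_energy_le A z)).2)

instance (A : Finset (Sym2 L)) : IsProbabilityMeasure (bondMeasure χ v A) :=
  isProbabilityMeasure_tilted (integrable_exp_energy A)

lemma integral_bondMeasure (A : Finset (Sym2 L)) (f : (L → Loop M) → ℝ) :
    ∫ z, f z ∂bondMeasure χ v A =
      (∫ z, Real.exp (energy v A z) ∂Measure.infinitePi χ)⁻¹ *
        ∫ z, Real.exp (energy v A z) * f z ∂Measure.infinitePi χ := by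
  rw [bondMeasure, integral_tilted, ← integral_const_mul]
  simp only [smul_eq_mul, div_eq_inv_mul, mul_assoc]

lemma abs_exp_energy_mul_le (A : Finset (Sym2 L)) {f : (L → Loop M) → ℝ} {K : ℝ}
    (hK : ∀ z, |f z| ≤ K) (z : L → Loop M) :
    |Real.exp (energy v A z) * f z| ≤ Real.exp (∑ e ∈ A, bondNorm v e) * K := by
  rw [abs_mul, abs_of_pos (Real.exp_pos _)]
  exact mul_le_mul (Real.exp_le_exp.2 (abs_le.1 (abs_energy_le A z)).2) (hK z) (abs_nonneg _)
    (Real.exp_pos _).le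

lemma measurable_exp_energy (A : Finset (Sym2 L)) :
    Measurable fun z : L → Loop M => Real.exp (energy v A z) :=
  (Real.continuous_exp.comp (continuous_energy A)).measurable

section

variable (hv : ∀ ℓ ℓ', v ℓ ℓ' = v ℓ' ℓ)
  (hv' : ∀ ℓ ℓ' (ξ η : M), v ℓ ℓ' (ξ, η) = v ℓ ℓ' (η, ξ))

include hv hv'

/-- The DLR equation in `Λ` for the interactions along a finite set of bonds containing all those
which meet `Λ`. -/
lemma integral_gibbsKernel_bondMeasure {Λ : Finset L} {A : Finset (Sym2 L)} (hΛA : G.bonds Λ ⊆ A)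
    (hA : ∀ e ∈ A, e ∈ G.edgeSet) {f : (L → Loop M) → ℝ} (hf : Continuous f) {K : ℝ}
    (hK : ∀ z, |f z| ≤ K) :
    ∫ y, ∫ z, f z ∂gibbsKernel G χ v Λ y ∂bondMeasure χ v A = ∫ z, f z ∂bondMeasure χ v A := by
  set g : (L → Loop M) → ℝ := fun y => ∫ z, f z ∂gibbsKernel G χ v Λ y with hg
  have hgm : Measurable g := (continuous_integral_gibbsKernel hv hv' Λ hf hK).measurable
  have hgK : ∀ y, |g y| ≤ K := fun y => by
    have := isProbabilityMeasure_gibbsKernel (G := G) (χ := χ) hv hv' Λ y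
    have h := norm_integral_le_of_norm_le_const (μ := gibbsKernel G χ v Λ y) (f := f)
      (.of_forall hK)
    simpa using h
  have hgg : ∀ x z, g (Λ.glue x z) = g z := by
    intro x z
    simp only [hg, integral_gibbsKernel hv hv' Λ _ hf.measurable, weight, glue_glue]
  have hsplit : ∀ x z, Real.exp (energy v A (Λ.glue x z)) =
      Real.exp (energy v (A \ G.bonds Λ) z) * weight G v Λ z x := by
    intro x z
    have h : energy v (A \ G.bonds Λ) (Λ.glue x z) = energy v (A \ G.bonds Λ) z := by
      refine energy_congr fun e he a hae => glue_of_notMem fun haΛ => ?_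
      rw [Finset.mem_sdiff, SimpleGraph.mem_bonds] at he
      exact he.2 ⟨hA e he.1, a, haΛ, hae⟩
    rw [weight, ← Real.exp_add, ← h, energy, energy, energy, Finset.sum_sdiff hΛA]
  rw [integral_bondMeasure, integral_bondMeasure]
  congr 1
  refine (integral_infinitePi_eq Λ (h := fun z => Real.exp (energy v A z) * g z)
    ((measurable_exp_energy A).mul hgm) (abs_exp_energy_mul_le A hgK)).trans (Eq.trans ?_
    (integral_infinitePi_eq Λ (h := fun z => Real.exp (energy v A z) * f z)
      ((measurable_exp_energy A).mul hf.measurable) (abs_exp_energy_mul_le A hK)).symm)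
  refine integral_congr_ae (.of_forall fun z => ?_)
  have hZ := integral_weight_pos (G := G) (v := v) (χ := χ) Λ z
  simp only [hsplit, hgg, mul_assoc, integral_const_mul, integral_mul_const]
  congr 1
  simp only [hg]
  rw [integral_gibbsKernel hv hv' Λ _ hf.measurable, mul_inv_cancel_left₀ hZ.ne']

end

/-- The one-site marginals are uniformly dominated by the single-spin measures. -/
lemma bondMeasure_eval_preimage_le {A : Finset (Sym2 L)} (hA : ∀ e ∈ A, e ∈ G.edgeSet) (ℓ : L)
    {B : Set (Loop M)} (hB : MeasurableSet B) :
    bondMeasure χ v A ((fun z => z ℓ) ⁻¹' B) ≤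
      ENNReal.ofReal (Real.exp (2 * ∑ e ∈ G.bonds {ℓ}, bondNorm v e)) * χ ℓ B := by
  set b := ∑ e ∈ G.bonds {ℓ}, bondNorm v e with hb
  set f : (L → Loop M) → ℝ := ((fun z : L → Loop M => z ℓ) ⁻¹' B).indicator 1 with hf
  have hBm : MeasurableSet ((fun z : L → Loop M => z ℓ) ⁻¹' B) := measurable_pi_apply ℓ hB
  have hfm : Measurable f := measurable_one.indicator hBm
  have hf0 : ∀ z, 0 ≤ f z := Set.indicator_nonneg fun _ _ => zero_le_one
  have hf1 : ∀ z, |f z| ≤ 1 := fun z => by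
    rw [abs_of_nonneg (hf0 z)]
    exact Set.indicator_le_self' (fun _ _ => zero_le_one) z
  have hW : ∀ (x : ({ℓ} : Finset L) → Loop M) z,
      Real.exp (energy v A (Finset.glue {ℓ} x z)) ≤ Real.exp (2 * b) * Real.exp (energy v A z) := by
    intro x z
    rw [← Real.exp_add, Real.exp_le_exp, ← sub_le_iff_le_add, energy, energy,
      ← Finset.sum_sub_distrib, hb, Finset.mul_sum]
    have h0 : ∀ e ∈ A, e ∉ A ∩ G.bonds {ℓ} →
        bondV v (Finset.glue {ℓ} x z) e - bondV v z e = 0 := by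
      intro e he he'
      refine sub_eq_zero.2 (bondV_congr fun a hae => glue_of_notMem fun ha => he' ?_)
      exact Finset.mem_inter.2 ⟨he, SimpleGraph.mem_bonds.2 ⟨hA e he, a, ha, hae⟩⟩
    rw [← Finset.sum_subset Finset.inter_subset_left h0]
    refine (Finset.sum_le_sum fun e _ => ?_).trans (Finset.sum_le_sum_of_subset_of_nonneg
      Finset.inter_subset_right fun e _ _ => mul_nonneg zero_le_two (bondNorm_nonneg e))
    linarith [(abs_le.1 (abs_bondV_le (v := v) (Finset.glue {ℓ} x z) e)).2,
      (abs_le.1 (abs_bondV_le (v := v) z e)).1]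
  have hmarg : ∀ z, ∫ x, f (Finset.glue {ℓ} x z) ∂chiProd χ {ℓ} = (χ ℓ).real B := by
    intro z
    have hmp := measurePreserving_eval (fun a : ({ℓ} : Finset L) => χ a)
      ⟨ℓ, Finset.mem_singleton_self ℓ⟩
    have h : (fun x => f (Finset.glue {ℓ} x z)) =
        (Function.eval (⟨ℓ, Finset.mem_singleton_self ℓ⟩ : ({ℓ} : Finset L)) ⁻¹' B).indicator
          1 := by
      ext x
      have h : Finset.glue {ℓ} x z ∈ (fun z : L → Loop M => z ℓ) ⁻¹' B ↔ x ∈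
          Function.eval (⟨ℓ, Finset.mem_singleton_self ℓ⟩ : ({ℓ} : Finset L)) ⁻¹' B := by
        rw [Set.mem_preimage, Set.mem_preimage, glue_of_mem (Finset.mem_singleton_self ℓ)]
      classical
      rw [hf, Set.indicator_apply, Set.indicator_apply]
      exact if_congr h rfl rfl
    rw [h, chiProd, integral_indicator_one (hmp.measurable hB), measureReal_def,
      hmp.measure_preimage hB.nullMeasurableSet, measureReal_def]
  have hmain : ∫ z, f z ∂bondMeasure χ v A ≤ Real.exp (2 * b) * (χ ℓ).real B := by
    rw [integral_bondMeasure, inv_mul_le_iff₀ (integral_exp_pos (integrable_exp_energy A)),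
      ← integral_mul_const]
    refine (integral_infinitePi_eq {ℓ} (h := fun z => Real.exp (energy v A z) * f z)
      ((measurable_exp_energy A).mul hfm) (abs_exp_energy_mul_le A hf1)).le.trans ?_
    refine integral_mono_of_nonneg (.of_forall fun z => integral_nonneg fun x =>
      mul_nonneg (Real.exp_pos _).le (hf0 _)) ((integrable_exp_energy A).mul_const _)
      (.of_forall fun z => ?_)
    have hfint : Integrable (fun x => f (Finset.glue {ℓ} x z)) (chiProd χ {ℓ}) :=
      .of_bound (hfm.comp (measurable_glue_left {ℓ} z)).aestronglyMeasurable 1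
        (.of_forall fun x => hf1 _)
    calc ∫ x, Real.exp (energy v A (Finset.glue {ℓ} x z)) * f (Finset.glue {ℓ} x z) ∂chiProd χ {ℓ}
        ≤ ∫ x, Real.exp (2 * b) * Real.exp (energy v A z) * f (Finset.glue {ℓ} x z)
            ∂chiProd χ {ℓ} :=
          integral_mono_of_nonneg (.of_forall fun x => mul_nonneg (Real.exp_pos _).le (hf0 _))
            (hfint.const_mul _)
            (.of_forall fun x => mul_le_mul_of_nonneg_right (hW x z) (hf0 _))
      _ = Real.exp (energy v A z) * (Real.exp (2 * b) * (χ ℓ).real B) := by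
          rw [integral_const_mul, hmarg]
          ring
  rw [hf, integral_indicator_one hBm] at hmain
  rw [← ofReal_measureReal, ← ofReal_measureReal (μ := χ ℓ),
    ← ENNReal.ofReal_mul (Real.exp_pos _).le]
  exact ENNReal.ofReal_le_ofReal hmain

lemma exists_isCompact_bondMeasure_compl_le {ε : ENNReal} (hε : 0 < ε) :
    ∃ K : Set (L → Loop M), IsCompact K ∧
      ∀ A : Finset (Sym2 L), (∀ e ∈ A, e ∈ G.edgeSet) → bondMeasure χ v A Kᶜ ≤ ε := by
  obtain ⟨ε', hε'0, hε'⟩ := ENNReal.exists_pos_sum_of_countable hε.ne' L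
  have hK : ∀ ℓ, ∃ K : Set (Loop M), IsCompact K ∧
      ENNReal.ofReal (Real.exp (2 * ∑ e ∈ G.bonds {ℓ}, bondNorm v e)) * χ ℓ Kᶜ ≤ ε' ℓ := by
    intro ℓ
    have hc : (0 : ENNReal) < ENNReal.ofReal (Real.exp (2 * ∑ e ∈ G.bonds {ℓ}, bondNorm v e)) :=
      ENNReal.ofReal_pos.2 (Real.exp_pos _)
    obtain ⟨K, hK, h⟩ := isTightMeasureSet_iff_exists_isCompact_measure_compl_le.1
      (isTightMeasureSet_singleton (μ := χ ℓ)) (ε' ℓ /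
        ENNReal.ofReal (Real.exp (2 * ∑ e ∈ G.bonds {ℓ}, bondNorm v e)))
        (ENNReal.div_pos (by exact_mod_cast (hε'0 ℓ).ne') ENNReal.ofReal_ne_top)
    refine ⟨K, hK, ?_⟩
    have := h _ rfl
    rwa [ENNReal.le_div_iff_mul_le (.inl hc.ne') (.inl ENNReal.ofReal_ne_top), mul_comm] at this
  choose K hKc hKε using hK
  refine ⟨Set.univ.pi K, isCompact_univ_pi hKc, fun A hA => ?_⟩
  have h : (Set.univ.pi K)ᶜ = ⋃ ℓ, (fun z : L → Loop M => z ℓ) ⁻¹' (K ℓ)ᶜ := by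
    ext z
    simp
  rw [h]
  refine (measure_iUnion_le _).trans (le_trans (ENNReal.tsum_le_tsum fun ℓ => ?_) hε'.le)
  exact (bondMeasure_eval_preimage_le hA ℓ (hKc ℓ).isClosed.measurableSet.compl).trans (hKε ℓ)

lemma exists_isGibbs (hv : ∀ ℓ ℓ', v ℓ ℓ' = v ℓ' ℓ)
    (hv' : ∀ ℓ ℓ' (ξ η : M), v ℓ ℓ' (ξ, η) = v ℓ ℓ' (η, ξ)) :
    ∃ μ : Measure (L → Loop M), IsGibbs G χ v μ := by
  let m : Finset L → ProbabilityMeasure (L → Loop M) := fun Λ =>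
    ⟨bondMeasure χ v (G.bonds Λ), inferInstance⟩
  have hedge : ∀ Λ : Finset L, ∀ e ∈ G.bonds Λ, e ∈ G.edgeSet := fun Λ e he =>
    (SimpleGraph.mem_bonds.1 he).1
  have htight : IsTightMeasureSet
      {((μ : ProbabilityMeasure (L → Loop M)) : Measure (L → Loop M)) | μ ∈ Set.range m} := by
    refine isTightMeasureSet_iff_exists_isCompact_measure_compl_le.2 fun ε hε => ?_
    obtain ⟨K, hK, h⟩ := exists_isCompact_bondMeasure_compl_le (G := G) (χ := χ) (v := v) hε
    refine ⟨K, hK, ?_⟩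
    rintro _ ⟨_, ⟨Λ, rfl⟩, rfl⟩
    exact h _ (hedge Λ)
  let U : Ultrafilter (Finset L) := Ultrafilter.of atTop
  obtain ⟨μ, -, hμ⟩ := (isCompact_closure_of_isTightMeasureSet htight).ultrafilter_le_nhds
    (U.map m) (by
      rw [le_principal_iff]
      exact Ultrafilter.mem_map.2 (univ_mem' fun Λ => subset_closure ⟨Λ, rfl⟩))
  have hlim := ProbabilityMeasure.tendsto_iff_forall_integral_tendsto.1
    (show Tendsto m U (𝓝 μ) from hμ)
  refine ⟨μ, inferInstance, fun Λ _ => ?_⟩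
  let κ : ProbabilityTheory.Kernel (L → Loop M) (L → Loop M) :=
    ⟨gibbsKernel G χ v Λ, measurable_gibbsKernel hv hv' Λ⟩
  have hκ : ProbabilityTheory.IsMarkovKernel κ :=
    ⟨fun y => isProbabilityMeasure_gibbsKernel hv hv' Λ y⟩
  have hfin : IsFiniteMeasure ((μ : Measure (L → Loop M)).bind (gibbsKernel G χ v Λ)) :=
    inferInstanceAs (IsFiniteMeasure ((μ : Measure (L → Loop M)).bind κ))
  refine ext_of_forall_integral_eq_of_IsFiniteMeasure fun f => ?_
  have hfK : ∀ z, |f z| ≤ ‖f‖ := fun z => f.norm_coe_le_norm z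
  rw [integral_bind_gibbsKernel hv hv' Λ _ f.continuous.measurable hfK]
  let g : BoundedContinuousFunction (L → Loop M) ℝ := BoundedContinuousFunction.ofNormedAddCommGroup
    (fun y => ∫ z, f z ∂gibbsKernel G χ v Λ y)
    (continuous_integral_gibbsKernel hv hv' Λ f.continuous hfK) ‖f‖ fun y => by
      have := isProbabilityMeasure_gibbsKernel (G := G) (χ := χ) hv hv' Λ y
      have h := norm_integral_le_of_norm_le_const (μ := gibbsKernel G χ v Λ y) (f := f)
        (.of_forall hfK)
      simpa using h
  refine tendsto_nhds_unique ((hlim g).congr' ?_) (hlim f)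
  have hU : (U : Filter (Finset L)) ≤ atTop := Ultrafilter.of_le _
  filter_upwards [hU (eventually_ge_atTop Λ)] with Λ' hΛ'
  exact integral_gibbsKernel_bondMeasure hv hv' (SimpleGraph.bonds_mono hΛ') (hedge Λ')
    f.continuous hfK

end Existence

end

noncomputable section

/-- **Theorem 1.**  Let `φ : ℕ → [1,∞)` be nondecreasing with `∑ n/φ(n) < ∞`.  Then there is a
`δ ∈ (0,1)`, depending only on `φ`, such that for every countable graph `G` with no isolated
vertices whose graph distance satisfies `ρ(ℓ,ℓ') ≥ φ(min{m_ℓ, m_{ℓ'}})`, every compact metric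
space `M`, every choice of single-spin (Wiener-bridge type) probability measures `χ_ℓ`, and
every family of symmetric interaction potentials `v` with
`κ(v) = sup_{⟨ℓ,ℓ'⟩∈E} 16[exp(4‖v_{ℓℓ'}‖) − 1] ≤ δ`, the set `𝒢(v)` of Euclidean Gibbs
measures is a singleton. -/
theorem uniqueness_small_interaction
    (φ : ℕ → ℝ) (hφ1 : ∀ n, 1 ≤ φ n) (hφmono : Monotone φ)
    (hφsum : Summable fun n : ℕ => (n : ℝ) / φ n) :
    ∃ δ ∈ Set.Ioo (0 : ℝ) 1,
      ∀ (L : Type) [Countable L] [DecidableEq L]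
        (G : SimpleGraph L) [DecidableRel G.Adj] [G.LocallyFinite],
        (∀ ℓ : L, 0 < G.degree ℓ) →
        (∀ ℓ ℓ' : L, ℓ ≠ ℓ' → G.Reachable ℓ ℓ' →
          φ (min (G.degree ℓ) (G.degree ℓ')) ≤ (G.dist ℓ ℓ' : ℝ)) →
        ∀ (M : Type) [MetricSpace M] [CompactSpace M]
          (χ : L → Measure (Loop M)), (∀ ℓ, IsProbabilityMeasure (χ ℓ)) →
        ∀ v : L → L → C(M × M, ℝ),
          (∀ ℓ ℓ', v ℓ ℓ' = v ℓ' ℓ) →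
          (∀ ℓ ℓ' (ξ η : M), v ℓ ℓ' (ξ, η) = v ℓ ℓ' (η, ξ)) →
          (∀ ℓ ℓ', G.Adj ℓ ℓ' → 16 * (Real.exp (4 * ‖v ℓ ℓ'‖) - 1) ≤ δ) →
          ∃! μ : Measure ((ℓ : L) → Loop M), IsGibbs G χ v μ := by
  have hS : 0 ≤ ∑' n : ℕ, (n : ℝ) / φ n :=
    tsum_nonneg fun n => div_nonneg n.cast_nonneg (zero_le_one.trans (hφ1 n))
  have hexp : Real.exp (-(3 * ∑' n : ℕ, (n : ℝ) / φ n)) ≤ 1 := Real.exp_le_one_iff.2 (by linarith)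
  have hδ : 0 < Real.exp (-(3 * ∑' n : ℕ, (n : ℝ) / φ n)) / 2 := by positivity
  refine ⟨Real.exp (-(3 * ∑' n : ℕ, (n : ℝ) / φ n)) / 2, ⟨hδ, by linarith⟩, ?_⟩
  intro L _ _ G _ _ _ hG M _ _ χ hχ v hv hv' hvδ
  have hGφ : G.DegreeSeparated φ := hG
  have hq : ∀ e ∈ G.edgeSet, Real.exp (4 * bondNorm v e) - 1 ≤
      Real.exp (-(3 * ∑' n : ℕ, (n : ℝ) / φ n)) / 2 := by
    intro e he
    have hadj : G.Adj (Quot.out e).1 (Quot.out e).2 := by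
      have h : s((Quot.out e).1, (Quot.out e).2) = e := Quot.out_eq e
      rwa [← SimpleGraph.mem_edgeSet, h]
    have h0 : 1 ≤ Real.exp (4 * bondNorm v e) :=
      Real.one_le_exp (mul_nonneg zero_le_four (bondNorm_nonneg e))
    have h : 16 * (Real.exp (4 * bondNorm v e) - 1) ≤ _ := hvδ _ _ hadj
    linarith
  obtain ⟨μ, hμ⟩ := exists_isGibbs (G := G) (χ := χ) hv hv'
  refine ⟨μ, hμ, fun μ' hμ' => ?_⟩
  exact hμ'.eq hv hv' hδ.le hq
    (fun Λ₀ _ hε => hGφ.exists_volume hφ1 hφmono hφsum hδ.le le_rfl hε Λ₀) hμ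

end
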